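/- arXiv:2011.14893 — 6 statements merged into one kernel-verified Lean document; each statement's English description precedes it below -/
import Mathlib

section
/- Let X and Y be i.i.d. Gamma(α, θ) random variables. Then E[(min{X,Y})^2] = θ^2 α(α+1) − (2θ^2/√π) · Γ(α + 3/2)/Γ(α). -/
open MeasureTheory ProbabilityTheory Real

namespace GammaMin

open Set Filter Topology

lemma gammaPDFReal_of_pos {a r x : ℝ} (hx : 0 < x) :
    gammaPDFReal a r x = r ^ a / Gamma a * x ^ (a - 1) * exp (-(r * x)) := if_pos hx.le

lemma support_gammaPDFReal_subset (a r : ℝ) : Function.support (gammaPDFReal a r) ⊆ Ici 0 := by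
  intro x hx
  by_contra h
  exact hx (if_neg h)

lemma measurable_gammaPDF (a r : ℝ) : Measurable (gammaPDF a r) :=
  (measurable_gammaPDFReal a r).ennreal_ofReal

lemma integral_gammaMeasure {a r : ℝ} (ha : 0 < a) (hr : 0 < r) (g : ℝ → ℝ) :
    ∫ x, g x ∂gammaMeasure a r = ∫ x in Ioi 0, gammaPDFReal a r x * g x := by
  rw [gammaMeasure, integral_withDensity_eq_integral_toReal_smul
    (measurable_gammaPDF a r) (by simp [gammaPDF]),
    ← integral_Ici_eq_integral_Ioi,
    setIntegral_eq_integral_of_forall_compl_eq_zero]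
  · simp [gammaPDF, ENNReal.toReal_ofReal, gammaPDFReal_nonneg ha hr]
  · intro x hx
    have : gammaPDFReal a r x = 0 := if_neg hx
    simp [this]

lemma integrable_gammaMeasure_iff {a r : ℝ} (ha : 0 < a) (hr : 0 < r) (g : ℝ → ℝ) :
    Integrable g (gammaMeasure a r) ↔
      IntegrableOn (fun x ↦ gammaPDFReal a r x * g x) (Ioi 0) := by
  rw [gammaMeasure, integrable_withDensity_iff_integrable_smul'
    (measurable_gammaPDF a r) (by simp [gammaPDF]),
    ← integrableOn_Ici_iff_integrableOn_Ioi,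
    integrableOn_iff_integrable_of_support_subset]
  · simp [gammaPDF, ENNReal.toReal_ofReal, gammaPDFReal_nonneg ha hr]
  · exact (Function.support_mul_subset_left _ _).trans (support_gammaPDFReal_subset a r)

lemma integrableOn_rpow_mul_exp_neg_mul {s b : ℝ} (hs : -1 < s) (hb : 0 < b) :
    IntegrableOn (fun x : ℝ ↦ x ^ s * exp (-(b * x))) (Ioi 0) := by
  simpa using integrableOn_rpow_mul_exp_neg_mul_rpow hs one_pos hb

lemma integrable_gammaPDFReal {a r : ℝ} (ha : 0 < a) (hr : 0 < r) :
    Integrable (gammaPDFReal a r) := by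
  have := isProbabilityMeasure_gammaMeasure ha hr
  have h := (integrable_gammaMeasure_iff ha hr fun _ ↦ 1).1 (integrable_const 1)
  simp only [mul_one] at h
  rwa [← integrableOn_Ici_iff_integrableOn_Ioi,
    integrableOn_iff_integrable_of_support_subset (support_gammaPDFReal_subset a r)] at h

lemma integral_Ioi_gammaPDFReal {a r : ℝ} (ha : 0 < a) (hr : 0 < r) :
    ∫ x in Ioi 0, gammaPDFReal a r x = 1 := by
  have := isProbabilityMeasure_gammaMeasure ha hr
  simpa using (integral_gammaMeasure ha hr fun _ ↦ 1).symm

lemma integrable_sq_gammaMeasure {a r : ℝ} (ha : 0 < a) (hr : 0 < r) :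
    Integrable (fun x ↦ x ^ 2) (gammaMeasure a r) := by
  rw [integrable_gammaMeasure_iff ha hr]
  refine IntegrableOn.congr_fun
    ((integrableOn_rpow_mul_exp_neg_mul (s := a + 1) (by linarith) hr).const_mul
      (r ^ a / Gamma a)) (fun x hx ↦ ?_) measurableSet_Ioi
  have hx : 0 < x := hx
  simp only [gammaPDFReal_of_pos hx]
  rw [show a + 1 = (a - 1) + (2 : ℕ) by push_cast; ring, rpow_add_natCast hx.ne']
  ring

/-- The boundary term in the integration by parts of `r ^ 2 * x ^ 2` against the gamma density. -/
noncomputable def gammaBoundary (a r x : ℝ) : ℝ :=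
  r ^ a / Gamma a * ((r * x ^ (a + 1) + (a + 1) * x ^ a) * exp (-(r * x)))

lemma gammaBoundary_zero {a : ℝ} (ha : 0 < a) (r : ℝ) : gammaBoundary a r 0 = 0 := by
  simp [gammaBoundary, zero_rpow ha.ne', zero_rpow (by linarith : a + 1 ≠ 0)]

lemma continuous_gammaBoundary {a : ℝ} (ha : 0 < a) (r : ℝ) : Continuous (gammaBoundary a r) := by
  have h1 := continuous_rpow_const ha.le
  have h2 := continuous_rpow_const (q := a + 1) (by linarith)
  unfold gammaBoundary
  fun_prop

lemma tendsto_gammaBoundary {a r : ℝ} (hr : 0 < r) :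
    Tendsto (gammaBoundary a r) atTop (𝓝 0) := by
  have h1 := tendsto_rpow_mul_exp_neg_mul_atTop_nhds_zero (a + 1) r hr
  have h2 := tendsto_rpow_mul_exp_neg_mul_atTop_nhds_zero a r hr
  have h := ((h1.const_mul r).add (h2.const_mul (a + 1))).const_mul (r ^ a / Gamma a)
  simp only [mul_zero, add_zero] at h
  refine h.congr fun x ↦ ?_
  simp only [gammaBoundary, neg_mul]
  ring

lemma hasDerivAt_gammaBoundary (a r : ℝ) {x : ℝ} (hx : 0 < x) :
    HasDerivAt (gammaBoundary a r)
      (a * (a + 1) * gammaPDFReal a r x - r ^ 2 * (gammaPDFReal a r x * x ^ 2)) x := by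
  have h1 := Real.hasDerivAt_rpow_const (x := x) (p := a + 1) (Or.inl hx.ne')
  have h2 := Real.hasDerivAt_rpow_const (x := x) (p := a) (Or.inl hx.ne')
  have h3 : HasDerivAt (fun x ↦ exp (-(r * x))) (exp (-(r * x)) * (-(r * 1))) x :=
    ((hasDerivAt_id x).const_mul r).neg.exp
  refine ((((h1.const_mul r).add (h2.const_mul (a + 1))).mul h3).const_mul
    (r ^ a / Gamma a)).congr_deriv ?_
  simp only [Pi.add_apply]
  rw [gammaPDFReal_of_pos hx, add_sub_cancel_right,
    show x ^ (a + 1) = x ^ (a - 1) * x ^ 2 by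
      rw [← rpow_add_natCast hx.ne']; congr 1; push_cast; ring,
    show x ^ a = x ^ (a - 1) * x by
      rw [← rpow_add_one hx.ne']; congr 1; ring]
  ring

lemma continuousAt_gammaPDFReal (a r : ℝ) {x : ℝ} (hx : 0 < x) :
    ContinuousAt (gammaPDFReal a r) x := by
  have h : ContinuousAt (fun x ↦ r ^ a / Gamma a * x ^ (a - 1) * exp (-(r * x))) x :=
    ((continuousAt_rpow_const x (a - 1) (Or.inl hx.ne')).const_mul _).mul (by fun_prop)
  refine h.congr ?_
  filter_upwards [lt_mem_nhds hx] with y hy using (gammaPDFReal_of_pos hy).symm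

lemma hasDerivAt_integral_gammaPDFReal {a r : ℝ} (ha : 0 < a) (hr : 0 < r) {x : ℝ} (hx : 0 < x) :
    HasDerivAt (fun t ↦ ∫ y in 0..t, gammaPDFReal a r y) (gammaPDFReal a r x) x :=
  intervalIntegral.integral_hasDerivAt_right (integrable_gammaPDFReal ha hr).intervalIntegrable
    (stronglyMeasurable_gammaPDFReal a r).stronglyMeasurableAtFilter
    (continuousAt_gammaPDFReal a r hx)

lemma integral_gammaPDFReal_mul_sq {a r : ℝ} (ha : 0 < a) (hr : 0 < r) {x : ℝ} (hx : 0 < x) :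
    r ^ 2 * ∫ y in 0..x, gammaPDFReal a r y * y ^ 2 =
      a * (a + 1) * (∫ y in 0..x, gammaPDFReal a r y) - gammaBoundary a r x := by
  have hp : IntervalIntegrable (gammaPDFReal a r) volume 0 x :=
    (integrable_gammaPDFReal ha hr).intervalIntegrable
  have hq : IntervalIntegrable (fun y ↦ gammaPDFReal a r y * y ^ 2) volume 0 x :=
    hp.mul_continuousOn (by fun_prop)
  have h := intervalIntegral.integral_eq_sub_of_hasDerivAt_of_le hx.le
    (continuous_gammaBoundary ha r).continuousOn
    (fun y hy ↦ hasDerivAt_gammaBoundary a r hy.1)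
    ((hp.const_mul (a * (a + 1))).sub (hq.const_mul (r ^ 2)))
  rw [intervalIntegral.integral_sub (hp.const_mul _) (hq.const_mul _),
    intervalIntegral.integral_const_mul, intervalIntegral.integral_const_mul,
    gammaBoundary_zero ha] at h
  linarith

lemma integral_min_sq_gammaMeasure {a r : ℝ} (ha : 0 < a) (hr : 0 < r) {x : ℝ} (hx : 0 < x) :
    r ^ 2 * ∫ y, min x y ^ 2 ∂gammaMeasure a r =
      a * (a + 1) * (∫ y in 0..x, gammaPDFReal a r y) - gammaBoundary a r x +
        r ^ 2 * x ^ 2 * (1 - ∫ y in 0..x, gammaPDFReal a r y) := by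
  have hp := integrable_gammaPDFReal ha hr
  have hq : IntegrableOn (fun y ↦ gammaPDFReal a r y * y ^ 2) (Ioc 0 x) :=
    (intervalIntegrable_iff_integrableOn_Ioc_of_le hx.le).1
      (hp.intervalIntegrable.mul_continuousOn (by fun_prop))
  have hlo : EqOn (fun y ↦ gammaPDFReal a r y * y ^ 2)
      (fun y ↦ gammaPDFReal a r y * min x y ^ 2) (Ioc 0 x) := fun y hy ↦ by
    simp only [min_eq_right hy.2]
  have hhi : EqOn (fun y ↦ gammaPDFReal a r y * x ^ 2)
      (fun y ↦ gammaPDFReal a r y * min x y ^ 2) (Ioi x) := fun y hy ↦ by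
    simp only [min_eq_left (mem_Ioi.1 hy).le]
  have hsplit : ∫ y in Ioi x, gammaPDFReal a r y = 1 - ∫ y in 0..x, gammaPDFReal a r y := by
    rw [← integral_Ioi_gammaPDFReal ha hr, ← Ioc_union_Ioi_eq_Ioi hx.le,
      setIntegral_union (Ioc_disjoint_Ioi le_rfl) measurableSet_Ioi hp.integrableOn
        hp.integrableOn, intervalIntegral.integral_of_le hx.le]
    ring
  rw [integral_gammaMeasure ha hr, ← Ioc_union_Ioi_eq_Ioi hx.le,
    setIntegral_union (Ioc_disjoint_Ioi le_rfl) measurableSet_Ioi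
      (hq.congr_fun hlo measurableSet_Ioc)
      ((hp.mul_const _).integrableOn.congr_fun hhi measurableSet_Ioi),
    ← setIntegral_congr_fun measurableSet_Ioc hlo, ← setIntegral_congr_fun measurableSet_Ioi hhi,
    integral_mul_const, hsplit, ← intervalIntegral.integral_of_le hx.le, mul_add,
    integral_gammaPDFReal_mul_sq ha hr hx]
  ring

lemma gammaPDFReal_mul_gammaBoundary (a r : ℝ) {x : ℝ} (hx : 0 < x) :
    gammaPDFReal a r x * gammaBoundary a r x =
      (r ^ a / Gamma a) ^ 2 * (r * (x ^ (2 * a + 1 - 1) * exp (-(2 * r * x))) +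
        (a + 1) * (x ^ (2 * a - 1) * exp (-(2 * r * x)))) := by
  rw [gammaPDFReal_of_pos hx, gammaBoundary,
    show x ^ (2 * a + 1 - 1) = x ^ (a - 1) * x ^ (a + 1) by rw [← rpow_add hx]; congr 1; ring,
    show x ^ (2 * a - 1) = x ^ (a - 1) * x ^ a by rw [← rpow_add hx]; congr 1; ring,
    show exp (-(2 * r * x)) = exp (-(r * x)) * exp (-(r * x)) by rw [← exp_add]; congr 1; ring]
  ring

lemma integrableOn_gammaPDFReal_mul_gammaBoundary {a r : ℝ} (ha : 0 < a) (hr : 0 < r) :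
    IntegrableOn (fun x ↦ gammaPDFReal a r x * gammaBoundary a r x) (Ioi 0) := by
  have h1 := integrableOn_rpow_mul_exp_neg_mul (s := 2 * a + 1 - 1) (b := 2 * r)
    (by linarith) (by linarith)
  have h2 := integrableOn_rpow_mul_exp_neg_mul (s := 2 * a - 1) (b := 2 * r)
    (by linarith) (by linarith)
  exact IntegrableOn.congr_fun (((h1.const_mul r).add (h2.const_mul (a + 1))).const_mul _)
    (fun x hx ↦ (gammaPDFReal_mul_gammaBoundary a r hx).symm) measurableSet_Ioi

lemma integral_gammaPDFReal_mul_gammaBoundary {a r : ℝ} (ha : 0 < a) (hr : 0 < r) :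
    ∫ x in Ioi 0, gammaPDFReal a r x * gammaBoundary a r x =
      Gamma (a + 3 / 2) / (√π * Gamma a) := by
  have h1 := integrableOn_rpow_mul_exp_neg_mul (s := 2 * a + 1 - 1) (b := 2 * r)
    (by linarith) (by linarith)
  have h2 := integrableOn_rpow_mul_exp_neg_mul (s := 2 * a - 1) (b := 2 * r)
    (by linarith) (by linarith)
  rw [setIntegral_congr_fun measurableSet_Ioi
      (fun x hx ↦ gammaPDFReal_mul_gammaBoundary a r hx), integral_const_mul,
    integral_add (h1.const_mul _) (h2.const_mul _), integral_const_mul, integral_const_mul,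
    integral_rpow_mul_exp_neg_mul_Ioi (by linarith) (by linarith),
    integral_rpow_mul_exp_neg_mul_Ioi (by linarith) (by linarith),
    Gamma_add_one (by linarith), one_div, inv_rpow (by linarith), inv_rpow (by linarith),
    rpow_add_one (by linarith), mul_rpow zero_le_two hr.le,
    show r ^ (2 * a) = r ^ a * r ^ a by rw [← rpow_add hr]; congr 1; ring,
    show a + 3 / 2 = (a + 1 / 2) + 1 by ring, Gamma_add_one (by linarith)]
  have hdup := Real.Gamma_mul_Gamma_add_half a
  rw [rpow_sub two_pos, rpow_one] at hdup
  have hG := (Gamma_pos_of_pos ha).ne'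
  have hra := (rpow_pos_of_pos hr a).ne'
  have h2a := (rpow_pos_of_pos two_pos (2 * a)).ne'
  have hpi := (sqrt_pos.2 pi_pos).ne'
  have hG2 : Gamma (2 * a) = Gamma a * Gamma (a + 1 / 2) * 2 ^ (2 * a) / (2 * √π) := by
    rw [hdup]; field_simp
  rw [hG2]
  field_simp
  ring

lemma integrable_min_sq_gammaMeasure_prod {a r : ℝ} (ha : 0 < a) (hr : 0 < r) :
    Integrable (fun z : ℝ × ℝ ↦ min z.1 z.2 ^ 2) ((gammaMeasure a r).prod (gammaMeasure a r)) := by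
  have := isProbabilityMeasure_gammaMeasure ha hr
  have h := integrable_sq_gammaMeasure ha hr
  refine ((h.comp_fst (gammaMeasure a r)).add (h.comp_snd (gammaMeasure a r))).mono'
    (Continuous.aestronglyMeasurable (by fun_prop)) (ae_of_all _ fun z ↦ ?_)
  rw [Real.norm_of_nonneg (sq_nonneg _)]
  rcases min_choice z.1 z.2 with h | h <;> rw [h] <;>
    simp only [Pi.add_apply] <;> nlinarith [sq_nonneg z.1, sq_nonneg z.2]

/-- The second moment of the minimum of two independent gamma variables of shape `a`, rate `r`. -/
lemma integral_min_sq_gammaMeasure_prod {a r : ℝ} (ha : 0 < a) (hr : 0 < r) :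
    r ^ 2 * ∫ z : ℝ × ℝ, min z.1 z.2 ^ 2 ∂(gammaMeasure a r).prod (gammaMeasure a r) =
      a * (a + 1) - 2 * (Gamma (a + 3 / 2) / (√π * Gamma a)) := by
  have := isProbabilityMeasure_gammaMeasure ha hr
  have hint := integrable_min_sq_gammaMeasure_prod ha hr
  have hp := integrable_gammaPDFReal ha hr
  have hM : IntegrableOn
      (fun x ↦ gammaPDFReal a r x * ∫ y, min x y ^ 2 ∂gammaMeasure a r) (Ioi 0) :=
    (integrable_gammaMeasure_iff ha hr _).1 hint.integral_prod_left
  have hG := integrableOn_gammaPDFReal_mul_gammaBoundary ha hr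
  have hF' : IntegrableOn
      (fun x ↦ r ^ 2 * (gammaPDFReal a r x * ∫ y, min x y ^ 2 ∂gammaMeasure a r) +
        2 * (gammaPDFReal a r x * gammaBoundary a r x)) (Ioi 0) :=
    (hM.const_mul (r ^ 2)).add (hG.const_mul 2)
  have hH : Continuous fun t ↦ ∫ y in 0..t, gammaPDFReal a r y :=
    intervalIntegral.continuous_primitive (fun _ _ ↦ hp.intervalIntegrable) 0
  have hHlim : Tendsto (fun t ↦ ∫ y in 0..t, gammaPDFReal a r y) atTop (𝓝 1) := by
    rw [← integral_Ioi_gammaPDFReal ha hr]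
    exact intervalIntegral_tendsto_integral_Ioi 0 hp.integrableOn tendsto_id
  have key := integral_Ioi_of_hasDerivAt_of_tendsto (a := 0) (m := a * (a + 1) * 1 - 0 * (1 - 1))
    (f := fun t ↦ a * (a + 1) * (∫ y in 0..t, gammaPDFReal a r y) -
      gammaBoundary a r t * (1 - ∫ y in 0..t, gammaPDFReal a r y))
    ((hH.const_mul _).sub ((continuous_gammaBoundary ha r).mul
      (continuous_const.sub hH))).continuousWithinAt
    (fun x hx ↦ (((hasDerivAt_integral_gammaPDFReal ha hr hx).const_mul (a * (a + 1))).sub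
      ((hasDerivAt_gammaBoundary a r hx).mul
        ((hasDerivAt_integral_gammaPDFReal ha hr hx).const_sub 1))).congr_deriv
      (g' := r ^ 2 * (gammaPDFReal a r x * ∫ y, min x y ^ 2 ∂gammaMeasure a r) +
        2 * (gammaPDFReal a r x * gammaBoundary a r x))
      (by linear_combination
            (-gammaPDFReal a r x) * integral_min_sq_gammaMeasure ha hr (x := x) hx))
    hF'
    ((hHlim.const_mul _).sub ((tendsto_gammaBoundary hr).mul (hHlim.const_sub 1)))
  rw [integral_add (hM.const_mul _) (hG.const_mul _), integral_const_mul, integral_const_mul,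
    integral_gammaPDFReal_mul_gammaBoundary ha hr, intervalIntegral.integral_same,
    gammaBoundary_zero ha] at key
  rw [integral_prod _ hint, integral_gammaMeasure ha hr]
  linarith

end GammaMin

/-- If `X, Y` are i.i.d. Gamma(shape `α`, scale `θ`) random variables, then
`E[(min{X,Y})^2] = θ^2 α(α+1) − (2θ^2/√π) Γ(α+3/2)/Γ(α)`. -/
theorem min_gamma_second_moment {Ω : Type*} [MeasureSpace Ω]
    [IsProbabilityMeasure (ℙ : Measure Ω)]
    (X Y : Ω → ℝ) (α θ : ℝ) (hα : 0 < α) (hθ : 0 < θ)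
    (hX : Measure.map X ℙ = gammaMeasure α θ⁻¹)
    (hY : Measure.map Y ℙ = gammaMeasure α θ⁻¹)
    (hindep : IndepFun X Y ℙ) :
    ∫ ω, (min (X ω) (Y ω)) ^ 2 ∂ℙ =
      θ ^ 2 * α * (α + 1) - (2 * θ ^ 2 / Real.sqrt π) * (Real.Gamma (α + 3/2) / Real.Gamma α) := by
  have := isProbabilityMeasure_gammaMeasure hα (inv_pos.2 hθ)
  have hXm : AEMeasurable X ℙ :=
    AEMeasurable.of_map_ne_zero (hX ▸ IsProbabilityMeasure.ne_zero _)
  have hYm : AEMeasurable Y ℙ :=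
    AEMeasurable.of_map_ne_zero (hY ▸ IsProbabilityMeasure.ne_zero _)
  have hlaw := hindep.map_prod_eq_prod_map_map hXm hYm
  rw [hX, hY] at hlaw
  have hmap := integral_map (hXm.prodMk hYm) (f := fun z : ℝ × ℝ ↦ min z.1 z.2 ^ 2)
    (Continuous.aestronglyMeasurable (by fun_prop))
  have hmain := GammaMin.integral_min_sq_gammaMeasure_prod hα (inv_pos.2 hθ)
  rw [← hlaw, hmap, inv_pow, inv_mul_eq_iff_eq_mul₀ (by positivity)] at hmain
  rw [hmain]
  have hG := (Gamma_pos_of_pos hα).ne'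
  have hpi := (sqrt_pos.2 pi_pos).ne'
  field_simp
end

section
/- Let X and Y be i.i.d. random variables with inverse Gamma distribution with shape α > 2 and scale θ > 0 (i.e., 1/X is Gamma(α, θ) distributed, density t ↦ t^(−α−1) e^(−1/(tθ))/(θ^α Γ(α)) on (0,∞)). Then for j ∈ {1,2}, E[(min{X,Y})^j] = θ^(−j) Γ(α−j)/Γ(α) − (j θ^(−j)/√π) · Γ(α−j) Γ(α−1/2)/Γ(α)^2. -/
open MeasureTheory ProbabilityTheory Real
open Set Filter Topology

/-- The unnormalised density of the gamma distribution with shape `a` and rate `r`. -/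
noncomputable def gammaKernel (r a x : ℝ) : ℝ := x ^ (a - 1) * exp (-(r * x))

/-- The lower incomplete gamma integral with shape `a` and rate `r`. -/
noncomputable def lowerGamma (r a x : ℝ) : ℝ := ∫ t in (0)..x, gammaKernel r a t

lemma gammaKernel_nonneg (r a : ℝ) {x : ℝ} (hx : 0 ≤ x) : 0 ≤ gammaKernel r a x := by
  unfold gammaKernel; positivity

lemma measurable_gammaKernel (r a : ℝ) : Measurable (gammaKernel r a) := by
  unfold gammaKernel; fun_prop

lemma continuousAt_gammaKernel (r a : ℝ) {x : ℝ} (hx : 0 < x) :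
    ContinuousAt (gammaKernel r a) x := by
  unfold gammaKernel
  exact (continuousAt_rpow_const _ _ (Or.inl hx.ne')).mul (by fun_prop)

lemma gammaKernel_mul_gammaKernel (r a b : ℝ) {x : ℝ} (hx : 0 < x) :
    gammaKernel r a x * gammaKernel r b x = gammaKernel (2 * r) (a + b - 1) x := by
  unfold gammaKernel
  rw [mul_mul_mul_comm, ← rpow_add hx, ← exp_add]
  ring_nf

lemma integral_gammaKernel {r a : ℝ} (hr : 0 < r) (ha : 0 < a) :
    ∫ x in Ioi 0, gammaKernel r a x = Real.Gamma a / r ^ a := by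
  unfold gammaKernel
  rw [integral_rpow_mul_exp_neg_mul_Ioi ha hr, one_div, inv_rpow hr.le]
  field_simp

lemma integrableOn_gammaKernel {r a : ℝ} (hr : 0 < r) (ha : 0 < a) :
    IntegrableOn (gammaKernel r a) (Ioi 0) := by
  simpa [gammaKernel] using!
    integrableOn_rpow_mul_exp_neg_mul_rpow (s := a - 1) (by linarith) one_pos hr

lemma intervalIntegrable_gammaKernel {r a x : ℝ} (hr : 0 < r) (ha : 0 < a) (hx : 0 ≤ x) :
    IntervalIntegrable (gammaKernel r a) volume 0 x :=
  (intervalIntegrable_iff_integrableOn_Ioc_of_le hx).2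
    ((integrableOn_gammaKernel hr ha).mono_set Ioc_subset_Ioi_self)

lemma lowerGamma_zero (r a : ℝ) : lowerGamma r a 0 = 0 := by simp [lowerGamma]

lemma lowerGamma_nonneg (r a : ℝ) {x : ℝ} (hx : 0 ≤ x) : 0 ≤ lowerGamma r a x :=
  intervalIntegral.integral_nonneg hx fun _ ht => gammaKernel_nonneg r a ht.1

lemma lowerGamma_le {r a x : ℝ} (hr : 0 < r) (ha : 0 < a) (hx : 0 ≤ x) :
    lowerGamma r a x ≤ Real.Gamma a / r ^ a := by
  rw [← integral_gammaKernel hr ha, lowerGamma, intervalIntegral.integral_of_le hx]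
  refine setIntegral_mono_set (integrableOn_gammaKernel hr ha) ?_
    Ioc_subset_Ioi_self.eventuallyLE
  filter_upwards [ae_restrict_mem measurableSet_Ioi] with t ht
  exact gammaKernel_nonneg r a (le_of_lt ht)

lemma hasDerivAt_lowerGamma {r a x : ℝ} (hr : 0 < r) (ha : 0 < a) (hx : 0 < x) :
    HasDerivAt (lowerGamma r a) (gammaKernel r a x) x :=
  intervalIntegral.integral_hasDerivAt_right (intervalIntegrable_gammaKernel hr ha hx.le)
    (measurable_gammaKernel r a).stronglyMeasurable.stronglyMeasurableAtFilter
    (continuousAt_gammaKernel r a hx)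

lemma continuousOn_lowerGamma {r a : ℝ} (hr : 0 < r) (ha : 0 < a) (x : ℝ) (hx : 0 ≤ x) :
    ContinuousOn (lowerGamma r a) (Icc 0 x) := by
  have h := intervalIntegral.continuousOn_primitive_interval'
    (intervalIntegrable_gammaKernel hr ha hx) left_mem_uIcc
  rwa [uIcc_of_le hx] at h

lemma tendsto_lowerGamma {r a : ℝ} (hr : 0 < r) (ha : 0 < a) :
    Tendsto (lowerGamma r a) atTop (𝓝 (Real.Gamma a / r ^ a)) := by
  rw [← integral_gammaKernel hr ha]
  exact intervalIntegral_tendsto_integral_Ioi 0 (integrableOn_gammaKernel hr ha) tendsto_id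

lemma lowerGamma_add_one {r a x : ℝ} (hr : 0 < r) (ha : 0 < a) (hx : 0 ≤ x) :
    r * lowerGamma r (a + 1) x = a * lowerGamma r a x - gammaKernel r (a + 1) x := by
  have h := intervalIntegral.integral_eq_sub_of_hasDerivAt_of_le hx
    (f := gammaKernel r (a + 1))
    (f' := fun t => a * gammaKernel r a t - r * gammaKernel r (a + 1) t) ?_ ?_ ?_
  · rw [intervalIntegral.integral_sub ((intervalIntegrable_gammaKernel hr ha hx).const_mul a)
      ((intervalIntegrable_gammaKernel hr (by linarith) hx).const_mul r),
      intervalIntegral.integral_const_mul, intervalIntegral.integral_const_mul] at h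
    have h0 : gammaKernel r (a + 1) 0 = 0 := by simp [gammaKernel, zero_rpow ha.ne']
    unfold lowerGamma
    linarith
  · unfold gammaKernel
    refine ContinuousOn.mul (fun t _ => ?_) (by fun_prop)
    exact (continuousAt_rpow_const _ _ (Or.inr (by linarith))).continuousWithinAt
  · intro t ht
    have h1 := Real.hasDerivAt_rpow_const (p := a) (Or.inl ht.1.ne')
    have h2 : HasDerivAt (fun t => exp (-(r * t))) (exp (-(r * t)) * (-(r * 1))) t :=
      ((hasDerivAt_id t).const_mul r).neg.exp
    have h3 := h1.mul h2
    unfold gammaKernel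
    simp only [add_sub_cancel_right]
    convert! h3 using 1
    ring
  · exact ((intervalIntegrable_gammaKernel hr ha hx).const_mul a).sub
      ((intervalIntegrable_gammaKernel hr (by linarith) hx).const_mul r)

lemma integrableOn_gammaKernel_mul_lowerGamma {r a b : ℝ} (hr : 0 < r) (ha : 0 < a)
    (hb : 0 < b) : IntegrableOn (fun x => gammaKernel r a x * lowerGamma r b x) (Ioi 0) := by
  refine (integrableOn_gammaKernel hr ha).mul_bdd (c := Real.Gamma b / r ^ b) ?_ ?_
  · refine ContinuousOn.aestronglyMeasurable (fun x hx => ?_) measurableSet_Ioi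
    exact (hasDerivAt_lowerGamma hr hb hx).continuousAt.continuousWithinAt
  · filter_upwards [ae_restrict_mem measurableSet_Ioi] with x hx
    rw [norm_of_nonneg (lowerGamma_nonneg r b (le_of_lt hx))]
    exact lowerGamma_le hr hb (le_of_lt hx)

lemma hasDerivAt_lowerGamma_sq {r a x : ℝ} (hr : 0 < r) (ha : 0 < a) (hx : 0 < x) :
    HasDerivAt (fun x => lowerGamma r a x ^ 2)
      (2 * (gammaKernel r a x * lowerGamma r a x)) x := by
  convert! (hasDerivAt_lowerGamma hr ha hx).pow 2 using 1
  push_cast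
  ring

lemma intervalIntegral_gammaKernel_mul_lowerGamma_self {r a x : ℝ} (hr : 0 < r) (ha : 0 < a)
    (hx : 0 ≤ x) :
    ∫ t in (0)..x, 2 * (gammaKernel r a t * lowerGamma r a t) = lowerGamma r a x ^ 2 := by
  rw [intervalIntegral.integral_eq_sub_of_hasDerivAt_of_le hx
    ((continuousOn_lowerGamma hr ha x hx).pow 2)
    (fun t ht => hasDerivAt_lowerGamma_sq hr ha ht.1)]
  · simp [lowerGamma_zero]
  · refine (intervalIntegrable_iff_integrableOn_Ioc_of_le hx).2 (Integrable.const_mul ?_ 2)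
    exact (integrableOn_gammaKernel_mul_lowerGamma hr ha ha).mono_set Ioc_subset_Ioi_self

lemma integral_gammaKernel_mul_lowerGamma_self {r a : ℝ} (hr : 0 < r) (ha : 0 < a) :
    ∫ x in Ioi 0, gammaKernel r a x * lowerGamma r a x = (Real.Gamma a / r ^ a) ^ 2 / 2 := by
  have h := intervalIntegral_tendsto_integral_Ioi 0
    ((integrableOn_gammaKernel_mul_lowerGamma hr ha ha).const_mul 2) tendsto_id
  have h' : Tendsto (fun x => ∫ t in (0)..x, 2 * (gammaKernel r a t * lowerGamma r a t)) atTop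
      (𝓝 ((Real.Gamma a / r ^ a) ^ 2)) := by
    refine ((tendsto_lowerGamma hr ha).pow 2).congr' ?_
    filter_upwards [eventually_ge_atTop 0] with x hx
    exact (intervalIntegral_gammaKernel_mul_lowerGamma_self hr ha hx).symm
  have := tendsto_nhds_unique h h'
  rw [integral_const_mul] at this
  linarith

lemma integral_gammaKernel_mul_lowerGamma_add_one {r a b : ℝ} (hr : 0 < r) (ha : 0 < a)
    (hb : 0 < b) :
    r * ∫ x in Ioi 0, gammaKernel r a x * lowerGamma r (b + 1) x =
      b * (∫ x in Ioi 0, gammaKernel r a x * lowerGamma r b x)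
        - Real.Gamma (a + b) / (2 * r) ^ (a + b) := by
  rw [← integral_gammaKernel (by positivity) (by positivity), ← integral_const_mul,
    ← integral_const_mul, ← integral_sub
      ((integrableOn_gammaKernel_mul_lowerGamma hr ha hb).const_mul b)
      (integrableOn_gammaKernel (by positivity) (by positivity))]
  refine setIntegral_congr_fun measurableSet_Ioi fun x hx => ?_
  have h1 := lowerGamma_add_one hr hb (le_of_lt hx)
  have h2 := gammaKernel_mul_gammaKernel r a (b + 1) hx
  rw [show a + (b + 1) - 1 = a + b by ring] at h2
  simp only [← h2]
  linear_combination gammaKernel r a x * h1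

lemma Gamma_two_mul_div_rpow {r a : ℝ} (hr : 0 < r) :
    Real.Gamma (2 * a) / (2 * r) ^ (2 * a) =
      Real.Gamma a * Real.Gamma (a + 1 / 2) / (2 * √π * r ^ (2 * a)) := by
  have h2 : (0 : ℝ) < 2 ^ (2 * a) := by positivity
  have hrr : 0 < r ^ (2 * a) := by positivity
  have hπ : 0 < √π := by positivity
  rw [Real.Gamma_mul_Gamma_add_half, rpow_sub two_pos, rpow_one, mul_rpow two_pos.le hr.le]
  field_simp

lemma rpow_mul_integral_gammaKernel_mul_lowerGamma_add_one {r a : ℝ} (hr : 0 < r) (ha : 0 < a) :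
    r ^ (2 * a + 1) * ∫ x in Ioi 0, gammaKernel r a x * lowerGamma r (a + 1) x =
      Real.Gamma a / 2 * (Real.Gamma (a + 1) - Real.Gamma (a + 1 / 2) / √π) := by
  have hrr : 0 < r ^ a := by positivity
  have hπ : 0 < √π := by positivity
  have h := integral_gammaKernel_mul_lowerGamma_add_one hr ha ha
  rw [integral_gammaKernel_mul_lowerGamma_self hr ha, ← two_mul,
    Gamma_two_mul_div_rpow hr] at h
  have hsq : r ^ (2 * a) = (r ^ a) ^ 2 := by
    rw [mul_comm, rpow_mul hr.le, rpow_two]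
  rw [rpow_add hr, rpow_one, mul_assoc, h, hsq, Real.Gamma_add_one ha.ne']
  field_simp

lemma rpow_mul_integral_gammaKernel_mul_lowerGamma_add_two {r a : ℝ} (hr : 0 < r) (ha : 0 < a) :
    r ^ (2 * a + 2) * ∫ x in Ioi 0, gammaKernel r a x * lowerGamma r (a + 2) x =
      Real.Gamma a / 2 * (Real.Gamma (a + 2) - 2 * Real.Gamma (a + 3 / 2) / √π) := by
  have hrr : 0 < r ^ (2 * a) := by positivity
  have hπ : 0 < √π := by positivity
  have h1 := rpow_mul_integral_gammaKernel_mul_lowerGamma_add_one hr ha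
  have h2 := integral_gammaKernel_mul_lowerGamma_add_one hr ha (b := a + 1) (by linarith)
  have hG := Gamma_two_mul_div_rpow (a := a) hr
  have hsplit : r ^ (2 * a + 2) = r ^ (2 * a + 1) * r := by
    rw [← rpow_add_one hr.ne']; ring_nf
  rw [show a + 1 + 1 = a + 2 by ring, show a + (a + 1) = 2 * a + 1 by ring,
    Real.Gamma_add_one (by positivity), rpow_add_one (by positivity), mul_comm (_ ^ _) (2 * r),
    mul_div_mul_comm, hG] at h2
  rw [hsplit, mul_assoc, h2, mul_sub, mul_left_comm, h1, rpow_add_one hr.ne',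
    show a + 2 = a + 1 + 1 by ring, Real.Gamma_add_one (by positivity : a + 1 ≠ 0),
    show a + 3 / 2 = a + 1 / 2 + 1 by ring, Real.Gamma_add_one (by positivity : a + 1 / 2 ≠ 0)]
  field_simp
  ring

lemma gammaMeasure_Iic {r a : ℝ} (hr : 0 < r) (ha : 0 < a) (x : ℝ) (hx : 0 ≤ x) :
    gammaMeasure a r (Iic x) = ENNReal.ofReal (r ^ a / Real.Gamma a * lowerGamma r a x) := by
  have hΓ := Gamma_pos_of_pos ha
  rw [gammaMeasure, withDensity_apply _ measurableSet_Iic,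
    lintegral_Iic_eq_lintegral_Iio_add_Icc _ hx, lintegral_gammaPDF_of_nonpos le_rfl, zero_add,
    lowerGamma, intervalIntegral.integral_of_le hx, ← integral_const_mul,
    ← integral_Icc_eq_integral_Ioc, ofReal_integral_eq_lintegral_ofReal]
  · refine setLIntegral_congr_fun measurableSet_Icc fun t ht => ?_
    simp only [gammaPDF_of_nonneg ht.1, gammaKernel, mul_assoc]
  · refine Integrable.const_mul ?_ _
    exact (integrableOn_Icc_iff_integrableOn_Ioc (by simp)).2
      ((integrableOn_gammaKernel hr ha).mono_set Ioc_subset_Ioi_self)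
  · filter_upwards [ae_restrict_mem measurableSet_Icc] with t ht
    exact mul_nonneg (by positivity) (gammaKernel_nonneg r a ht.1)

lemma gammaMeasure_Iic_zero {r a : ℝ} (hr : 0 < r) (ha : 0 < a) :
    gammaMeasure a r (Iic 0) = 0 := by
  simp [gammaMeasure_Iic hr ha 0 le_rfl, lowerGamma_zero]

/-- The law of the maximum of two independent gamma variables. -/
lemma map_max_gamma {Ω : Type*} [MeasurableSpace Ω] {P : Measure Ω} [IsProbabilityMeasure P]
    {U V : Ω → ℝ} {r a : ℝ} (hr : 0 < r) (ha : 0 < a)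
    (hUm : AEMeasurable U P) (hVm : AEMeasurable V P)
    (hU : P.map U = gammaMeasure a r) (hV : P.map V = gammaMeasure a r) (hUV : IndepFun U V P) :
    P.map (fun ω => max (U ω) (V ω)) = (volume.restrict (Ioi 0)).withDensity fun x =>
      ENNReal.ofReal ((r ^ a / Real.Gamma a) ^ 2 *
        (2 * (gammaKernel r a x * lowerGamma r a x))) := by
  have hΓ := Gamma_pos_of_pos ha
  have := Measure.isProbabilityMeasure_map (hUm.max hVm)
  refine Measure.ext_of_Iic _ _ fun x => ?_
  have hL : P.map (fun ω => max (U ω) (V ω)) (Iic x) = gammaMeasure a r (Iic x) ^ 2 := by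
    rw [Measure.map_apply_of_aemeasurable (hUm.max hVm) measurableSet_Iic, sq]
    nth_rewrite 1 [← hU]
    rw [← hV, Measure.map_apply_of_aemeasurable hUm measurableSet_Iic,
      Measure.map_apply_of_aemeasurable hVm measurableSet_Iic,
      ← hUV.measure_inter_preimage_eq_mul _ _ measurableSet_Iic measurableSet_Iic]
    congr 1
    ext ω
    simp
  rw [hL, withDensity_apply _ measurableSet_Iic, Measure.restrict_restrict measurableSet_Iic,
    inter_comm, Ioi_inter_Iic]
  rcases le_or_gt x 0 with hx | hx
  · rw [measure_mono_null (Iic_subset_Iic.2 hx) (gammaMeasure_Iic_zero hr ha), Ioc_eq_empty_of_le hx]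
    simp
  · rw [gammaMeasure_Iic hr ha x hx.le, ← ENNReal.ofReal_pow
      (mul_nonneg (by positivity) (lowerGamma_nonneg r a hx.le)), mul_pow,
      ← intervalIntegral_gammaKernel_mul_lowerGamma_self hr ha hx.le,
      intervalIntegral.integral_of_le hx.le, ← integral_const_mul,
      ofReal_integral_eq_lintegral_ofReal]
    · refine Integrable.const_mul (Integrable.const_mul ?_ _) _
      exact (integrableOn_gammaKernel_mul_lowerGamma hr ha ha).mono_set Ioc_subset_Ioi_self
    · filter_upwards [ae_restrict_mem measurableSet_Ioc] with t ht
      have := gammaKernel_nonneg r a ht.1.le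
      have := lowerGamma_nonneg r a ht.1.le
      simp only [Pi.zero_apply]
      positivity

lemma integral_max_gamma_inv_pow {Ω : Type*} [MeasurableSpace Ω] {P : Measure Ω}
    [IsProbabilityMeasure P] {U V : Ω → ℝ} {r a : ℝ} (hr : 0 < r) (ha : 0 < a)
    (hUm : AEMeasurable U P) (hVm : AEMeasurable V P)
    (hU : P.map U = gammaMeasure a r) (hV : P.map V = gammaMeasure a r) (hUV : IndepFun U V P)
    (j : ℕ) :
    ∫ ω, (max (U ω) (V ω))⁻¹ ^ j ∂P = 2 * (r ^ a / Real.Gamma a) ^ 2 *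
      ∫ x in Ioi 0, gammaKernel r (a - j) x * lowerGamma r a x := by
  have hΓ := Gamma_pos_of_pos ha
  have hmeas : AEMeasurable (fun x => ENNReal.ofReal ((r ^ a / Real.Gamma a) ^ 2 *
      (2 * (gammaKernel r a x * lowerGamma r a x)))) (volume.restrict (Ioi 0)) :=
    (((integrableOn_gammaKernel_mul_lowerGamma hr ha ha).aemeasurable.const_mul 2).const_mul
      _).ennreal_ofReal
  rw [← integral_map (f := fun x : ℝ => x⁻¹ ^ j) (hUm.max hVm)
    (by fun_prop : Measurable fun x : ℝ => x⁻¹ ^ j).aestronglyMeasurable,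
    map_max_gamma hr ha hUm hVm hU hV hUV,
    integral_withDensity_eq_integral_toReal_smul₀ hmeas (ae_of_all _ fun _ => by simp),
    ← integral_const_mul]
  refine setIntegral_congr_fun measurableSet_Ioi fun x (hx : 0 < x) => ?_
  have h1 := gammaKernel_nonneg r a hx.le
  have h2 := lowerGamma_nonneg r a hx.le
  have h3 : gammaKernel r (a - j) x = gammaKernel r a x * x⁻¹ ^ j := by
    unfold gammaKernel
    rw [show a - j - 1 = a - 1 - j by ring, rpow_sub hx, rpow_natCast, inv_pow]
    ring
  rw [ENNReal.toReal_ofReal (by positivity), h3, smul_eq_mul]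
  ring

lemma aemeasurable_of_map_eq_gammaMeasure {Ω : Type*} [MeasurableSpace Ω] {P : Measure Ω}
    {U : Ω → ℝ} {r a : ℝ} (hr : 0 < r) (ha : 0 < a) (hU : P.map U = gammaMeasure a r) :
    AEMeasurable U P := by
  have := isProbabilityMeasure_gammaMeasure ha hr
  exact aemeasurable_of_map_neZero (hU ▸ inferInstance)

lemma ae_pos_of_map_eq_gammaMeasure {Ω : Type*} [MeasurableSpace Ω] {P : Measure Ω}
    {U : Ω → ℝ} {r a : ℝ} (hr : 0 < r) (ha : 0 < a) (hU : P.map U = gammaMeasure a r) :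
    ∀ᵐ ω ∂P, 0 < U ω := by
  have h := gammaMeasure_Iic_zero hr ha
  rw [← hU, Measure.map_apply_of_aemeasurable (aemeasurable_of_map_eq_gammaMeasure hr ha hU)
    measurableSet_Iic] at h
  filter_upwards [measure_eq_zero_iff_ae_notMem.1 h] with ω hω
  simpa using hω

/-- If `X, Y` are i.i.d. InverseGamma(shape `α > 2`, scale `θ`) random variables
(i.e. `1/X` is Gamma with shape `α` and scale `θ`, that is rate `θ⁻¹`), then for `j ∈ {1,2}`,
`E[(min{X,Y})^j] = θ^(−j) Γ(α−j)/Γ(α) − (j θ^(−j)/√π) Γ(α−j) Γ(α−1/2)/Γ(α)^2`. -/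
theorem min_invGamma_moment {Ω : Type*} [MeasureSpace Ω]
    [IsProbabilityMeasure (ℙ : Measure Ω)]
    (X Y : Ω → ℝ) (α θ : ℝ) (hα : 2 < α) (hθ : 0 < θ)
    (hX : Measure.map (fun ω => (X ω)⁻¹) ℙ = gammaMeasure α θ⁻¹)
    (hY : Measure.map (fun ω => (Y ω)⁻¹) ℙ = gammaMeasure α θ⁻¹)
    (hindep : IndepFun X Y ℙ) :
    ∀ j ∈ ({1, 2} : Set ℕ),
      ∫ ω, (min (X ω) (Y ω)) ^ j ∂ℙ =
        θ ^ (-(j : ℝ)) * Real.Gamma (α - j) / Real.Gamma α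
          - (j * θ ^ (-(j : ℝ)) / Real.sqrt π) *
              (Real.Gamma (α - j) * Real.Gamma (α - 1/2) / Real.Gamma α ^ 2) := by
  have hr : 0 < θ⁻¹ := inv_pos.2 hθ
  have hα0 : 0 < α := by linarith
  have key (j : ℕ) : ∫ ω, (min (X ω) (Y ω)) ^ j ∂ℙ = 2 * (θ⁻¹ ^ α / Real.Gamma α) ^ 2 *
      ∫ x in Ioi 0, gammaKernel θ⁻¹ (α - j) x * lowerGamma θ⁻¹ α x := by
    rw [← integral_max_gamma_inv_pow hr hα0 (aemeasurable_of_map_eq_gammaMeasure hr hα0 hX)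
      (aemeasurable_of_map_eq_gammaMeasure hr hα0 hY) hX hY
      (hindep.comp measurable_inv measurable_inv)]
    refine integral_congr_ae ?_
    filter_upwards [ae_pos_of_map_eq_gammaMeasure hr hα0 hX,
      ae_pos_of_map_eq_gammaMeasure hr hα0 hY] with ω hx hy
    rw [inv_pos] at hx hy
    congr 1
    rcases le_total (X ω) (Y ω) with h | h
    · rw [min_eq_left h, max_eq_left (inv_anti₀ hx h), inv_inv]
    · rw [min_eq_right h, max_eq_right (inv_anti₀ hy h), inv_inv]
  have hΓ := Gamma_pos_of_pos hα0
  have hπ : 0 < √π := by positivity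
  have hpow (j : ℕ) : (θ⁻¹ ^ α) ^ 2 = θ ^ (-(j : ℝ)) * θ⁻¹ ^ (2 * α - j) := by
    rw [rpow_neg hθ.le, ← inv_rpow hθ.le, ← rpow_add hr, add_sub_cancel, mul_comm 2 α,
      rpow_mul hr.le, rpow_two]
  rintro j (rfl | rfl)
  · have h := rpow_mul_integral_gammaKernel_mul_lowerGamma_add_one hr
      (by linarith : 0 < α - 1)
    rw [show 2 * (α - 1) + 1 = 2 * α - (1 : ℕ) by push_cast; ring, sub_add_cancel,
      show α - 1 + 1 / 2 = α - 1 / 2 by ring] at h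
    rw [key, div_pow, hpow 1]
    push_cast at h ⊢
    rw [show ∀ A B C D : ℝ, 2 * (A * B / C) * D = 2 * A / C * (B * D) by intros; ring, h]
    field_simp
  · have h := rpow_mul_integral_gammaKernel_mul_lowerGamma_add_two hr
      (by linarith : 0 < α - 2)
    rw [show 2 * (α - 2) + 2 = 2 * α - (2 : ℕ) by push_cast; ring, sub_add_cancel,
      show α - 2 + 3 / 2 = α - 1 / 2 by ring] at h
    rw [key, div_pow, hpow 2]
    push_cast at h ⊢
    rw [show ∀ A B C D : ℝ, 2 * (A * B / C) * D = 2 * A / C * (B * D) by intros; ring, h]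
    field_simp
end

section
/- If X, Y are i.i.d. InverseGamma(b^(−1) + 1, x^(−1) b) random variables with fixed x > 0 and 0 < b < 1, then E[min{X,Y} − x] = −(x/√π) · Γ(b^(−1) + 1/2)/Γ(b^(−1) + 1), and as b → 0⁺ this equals −x√(b/π) + O_x(b^(3/2)). -/
open MeasureTheory ProbabilityTheory Real
open Set Filter Topology

/-- The analytic expression of the gamma density on `(0, ∞)`, extended to all of `ℝ`. -/
noncomputable def gammaDensity (s r t : ℝ) : ℝ :=
  r ^ s / Gamma s * t ^ (s - 1) * exp (-(r * t))

lemma gammaDensity_nonneg {s r t : ℝ} (hs : 0 < s) (hr : 0 < r) (ht : 0 ≤ t) :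
    0 ≤ gammaDensity s r t := by
  unfold gammaDensity
  positivity

lemma continuous_gammaDensity {s : ℝ} (hs : 1 ≤ s) (r : ℝ) : Continuous (gammaDensity s r) := by
  have h : Continuous fun t : ℝ => t ^ (s - 1) := Real.continuous_rpow_const (by linarith)
  unfold gammaDensity
  fun_prop

lemma setIntegral_gammaDensity {s r : ℝ} (hs : 0 < s) (hr : 0 < r) :
    ∫ t in Ioi 0, gammaDensity s r t = 1 := by
  simp_rw [gammaDensity, mul_assoc]
  rw [integral_const_mul, integral_rpow_mul_exp_neg_mul_Ioi hs hr,
    div_rpow zero_le_one hr.le, one_rpow]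
  have := (Gamma_pos_of_pos hs).ne'
  have := (rpow_pos_of_pos hr s).ne'
  field_simp

lemma integrableOn_gammaDensity {s r : ℝ} (hs : 0 < s) (hr : 0 < r) :
    IntegrableOn (gammaDensity s r) (Ioi 0) :=
  not_imp_comm.1 integral_undef (by rw [setIntegral_gammaDensity hs hr]; exact one_ne_zero)

lemma tendsto_gammaDensity_atTop (s : ℝ) {r : ℝ} (hr : 0 < r) :
    Tendsto (gammaDensity s r) atTop (𝓝 0) := by
  have h := (tendsto_rpow_mul_exp_neg_mul_atTop_nhds_zero (s - 1) r hr).const_mul (r ^ s / Gamma s)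
  rw [mul_zero] at h
  refine h.congr fun t => ?_
  rw [gammaDensity, mul_assoc, neg_mul]

lemma gammaDensity_add_one {a r t : ℝ} (ha : 0 < a) (hr : 0 < r) (ht : 0 < t) :
    gammaDensity (a + 1) r t = r / a * t * gammaDensity a r t := by
  have hG := (Gamma_pos_of_pos ha).ne'
  rw [gammaDensity, gammaDensity, Gamma_add_one ha.ne', rpow_add_one hr.ne', add_sub_cancel_right,
    ← sub_add_cancel a 1, rpow_add_one ht.ne', sub_add_cancel]
  field_simp

lemma hasDerivAt_gammaDensity_add_one {a : ℝ} (ha : 1 ≤ a) {r : ℝ} (hr : 0 < r) (t : ℝ) :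
    HasDerivAt (gammaDensity (a + 1) r)
      (r * gammaDensity a r t - r * gammaDensity (a + 1) r t) t := by
  have ha0 : 0 < a := by linarith
  have hG := (Gamma_pos_of_pos ha0).ne'
  have h := ((hasDerivAt_rpow_const (x := t) (Or.inr ha)).const_mul
    (r ^ (a + 1) / Gamma (a + 1))).mul ((hasDerivAt_id t).const_mul r).neg.exp
  have hfun : gammaDensity (a + 1) r =
      (fun y => r ^ (a + 1) / Gamma (a + 1) * y ^ a) * fun y => exp ((-fun y => r * id y) y) := by
    ext y
    simp [gammaDensity]
  rw [hfun]
  refine h.congr_deriv ?_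
  simp only [gammaDensity, Gamma_add_one ha0.ne', rpow_add_one hr.ne', Pi.mul_apply, Pi.neg_apply,
    id]
  field_simp
  ring

lemma integral_gammaMeasure {s r : ℝ} (hs : 0 < s) (hr : 0 < r) (f : ℝ → ℝ) :
    ∫ t, f t ∂gammaMeasure s r = ∫ t in Ioi 0, gammaDensity s r t * f t := by
  have hm : Measurable (gammaPDF s r) := (measurable_gammaPDFReal s r).ennreal_ofReal
  rw [gammaMeasure, integral_withDensity_eq_integral_toReal_smul hm
    (ae_of_all _ fun t => ENNReal.ofReal_lt_top),
    ← integral_Ici_eq_integral_Ioi, ← integral_indicator measurableSet_Ici]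
  congr 1 with t
  rw [gammaPDF, ENNReal.toReal_ofReal (gammaPDFReal_nonneg hs hr t), smul_eq_mul, gammaPDFReal]
  by_cases ht : 0 ≤ t <;> simp [indicator, ht, gammaDensity]

lemma ae_pos_gammaMeasure (s r : ℝ) : ∀ᵐ t ∂gammaMeasure s r, 0 < t := by
  rw [ae_iff]
  simp only [not_lt]
  change gammaMeasure s r (Iic 0) = 0
  rw [gammaMeasure, withDensity_apply _ measurableSet_Iic, setLIntegral_congr Iio_ae_eq_Iic.symm]
  exact lintegral_gammaPDF_of_nonpos le_rfl

lemma integral_inv_gammaMeasure_add_one {a r : ℝ} (ha : 0 < a) (hr : 0 < r) :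
    ∫ t, t⁻¹ ∂gammaMeasure (a + 1) r = r / a := by
  rw [integral_gammaMeasure (by linarith) hr]
  have h : EqOn (fun t => gammaDensity (a + 1) r t * t⁻¹)
      (fun t => r / a * gammaDensity a r t) (Ioi 0) := fun t (ht : 0 < t) => by
    simp only [gammaDensity_add_one ha hr ht]
    field_simp
  rw [setIntegral_congr_fun measurableSet_Ioi h, integral_const_mul,
    setIntegral_gammaDensity ha hr, mul_one]

lemma integrable_inv_gammaMeasure_add_one {a r : ℝ} (ha : 0 < a) (hr : 0 < r) :
    Integrable (fun t : ℝ => t⁻¹) (gammaMeasure (a + 1) r) :=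
  not_imp_comm.1 integral_undef
    (by rw [integral_inv_gammaMeasure_add_one ha hr]; positivity)

lemma integrable_min_inv_prod_gammaMeasure {a r : ℝ} (ha : 0 < a) (hr : 0 < r) :
    Integrable (fun z : ℝ × ℝ => min z.1⁻¹ z.2⁻¹)
      ((gammaMeasure (a + 1) r).prod (gammaMeasure (a + 1) r)) := by
  have := isProbabilityMeasure_gammaMeasure (a := a + 1) (by linarith) hr
  refine ((integrable_inv_gammaMeasure_add_one ha hr).comp_fst _).mono'
    (Measurable.aestronglyMeasurable (by fun_prop)) ?_
  filter_upwards [Measure.quasiMeasurePreserving_fst.ae (ae_pos_gammaMeasure (a + 1) r),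
    Measure.quasiMeasurePreserving_snd.ae (ae_pos_gammaMeasure (a + 1) r)] with z h₁ h₂
  rw [norm_of_nonneg (le_min (inv_nonneg.2 h₁.le) (inv_nonneg.2 h₂.le))]
  exact min_le_left _ _

/-- The distribution function on `[0, ∞)` of the gamma law. -/
noncomputable def gammaDistFun (s r u : ℝ) : ℝ := ∫ t in (0 : ℝ)..u, gammaDensity s r t

lemma hasDerivAt_gammaDistFun {s : ℝ} (hs : 1 ≤ s) (r u : ℝ) :
    HasDerivAt (gammaDistFun s r) (gammaDensity s r u) u :=
  ((continuous_gammaDensity hs r).integral_hasStrictDerivAt 0 u).hasDerivAt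

lemma tendsto_gammaDistFun_atTop {s r : ℝ} (hs : 0 < s) (hr : 0 < r) :
    Tendsto (gammaDistFun s r) atTop (𝓝 1) := by
  rw [← setIntegral_gammaDensity hs hr]
  exact intervalIntegral_tendsto_integral_Ioi 0 (integrableOn_gammaDensity hs hr) tendsto_id

lemma gammaDistFun_nonneg {s r u : ℝ} (hs : 0 < s) (hr : 0 < r) (hu : 0 ≤ u) :
    0 ≤ gammaDistFun s r u :=
  intervalIntegral.integral_nonneg hu fun _ ht => gammaDensity_nonneg hs hr ht.1

lemma setIntegral_Ioi_gammaDensity {s r u : ℝ} (hs : 0 < s) (hr : 0 < r) (hu : 0 ≤ u) :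
    ∫ t in Ioi u, gammaDensity s r t = 1 - gammaDistFun s r u := by
  have hi := integrableOn_gammaDensity hs hr
  rw [← setIntegral_gammaDensity hs hr, gammaDistFun, intervalIntegral.integral_of_le hu,
    ← Ioc_union_Ioi_eq_Ioi hu, setIntegral_union (Ioc_disjoint_Ioi le_rfl) measurableSet_Ioi
      (hi.mono_set Ioc_subset_Ioi_self) (hi.mono_set (Ioi_subset_Ioi hu))]
  ring

lemma gammaDistFun_le_one {s r u : ℝ} (hs : 0 < s) (hr : 0 < r) (hu : 0 ≤ u) :
    gammaDistFun s r u ≤ 1 := by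
  have h : 0 ≤ ∫ t in Ioi u, gammaDensity s r t :=
    setIntegral_nonneg measurableSet_Ioi fun t (ht : u < t) =>
      gammaDensity_nonneg hs hr (hu.trans ht.le)
  rw [setIntegral_Ioi_gammaDensity hs hr hu] at h
  linarith

lemma gammaDistFun_add_one {a r : ℝ} (ha : 1 ≤ a) (hr : 0 < r) (u : ℝ) :
    gammaDistFun (a + 1) r u = gammaDistFun a r u - gammaDensity (a + 1) r u / r := by
  have h := intervalIntegral.integral_eq_sub_of_hasDerivAt (a := 0) (b := u)
    (f := fun t => gammaDistFun a r t - gammaDensity (a + 1) r t / r)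
    (f' := gammaDensity (a + 1) r)
    (fun t _ => ((hasDerivAt_gammaDistFun ha r t).sub
      ((hasDerivAt_gammaDensity_add_one ha hr t).div_const r)).congr_deriv
        (by field_simp; ring))
    ((continuous_gammaDensity (by linarith) r).intervalIntegrable 0 u)
  have h0 : gammaDensity (a + 1) r 0 = 0 := by
    simp [gammaDensity, zero_rpow (show a ≠ 0 by linarith)]
  rw [gammaDistFun, h, h0]
  simp [gammaDistFun]

lemma integral_min_inv_gammaMeasure_add_one {a r u : ℝ} (ha : 1 ≤ a) (hr : 0 < r) (hu : 0 < u) :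
    ∫ v, min u⁻¹ v⁻¹ ∂gammaMeasure (a + 1) r =
      u⁻¹ * gammaDistFun (a + 1) r u + r / a * (1 - gammaDistFun a r u) := by
  have ha0 : 0 < a := by linarith
  have h₁ : EqOn (fun v => gammaDensity (a + 1) r v * min u⁻¹ v⁻¹)
      (fun v => u⁻¹ * gammaDensity (a + 1) r v) (Ioc 0 u) := fun v hv => by
    simp only [min_eq_left (inv_anti₀ hv.1 hv.2), mul_comm]
  have h₂ : EqOn (fun v => gammaDensity (a + 1) r v * min u⁻¹ v⁻¹)
      (fun v => r / a * gammaDensity a r v) (Ioi u) := fun v (hv : u < v) => by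
    have hv0 := hu.trans hv
    simp only [min_eq_right (inv_anti₀ hu hv.le), gammaDensity_add_one ha0 hr hv0]
    field_simp
  rw [integral_gammaMeasure (by linarith) hr, ← Ioc_union_Ioi_eq_Ioi hu.le,
    setIntegral_union (Ioc_disjoint_Ioi le_rfl) measurableSet_Ioi,
    setIntegral_congr_fun measurableSet_Ioc h₁, setIntegral_congr_fun measurableSet_Ioi h₂,
    integral_const_mul, integral_const_mul, setIntegral_Ioi_gammaDensity ha0 hr hu.le,
    gammaDistFun.eq_def (a + 1), intervalIntegral.integral_of_le hu.le]
  · exact IntegrableOn.congr_fun (((integrableOn_gammaDensity (by linarith) hr).mono_set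
      Ioc_subset_Ioi_self).const_mul _) h₁.symm measurableSet_Ioc
  · exact IntegrableOn.congr_fun (((integrableOn_gammaDensity ha0 hr).mono_set
      (Ioi_subset_Ioi hu.le)).const_mul _) h₂.symm measurableSet_Ioi

lemma setIntegral_gammaDensity_mul_gammaDensity_add_one {a r : ℝ} (ha : 0 < a) (hr : 0 < r) :
    ∫ t in Ioi 0, gammaDensity a r t * gammaDensity (a + 1) r t =
      r / (2 * √π) * (Gamma (a + 1 / 2) / Gamma (a + 1)) := by
  have hG := (Gamma_pos_of_pos ha).ne'
  have hG' := (Gamma_pos_of_pos (show 0 < a + 1 by linarith)).ne'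
  have hra := (rpow_pos_of_pos hr a).ne'
  have h2a := (rpow_pos_of_pos (two_pos : (0 : ℝ) < 2) a).ne'
  have hπ := (sqrt_pos.2 pi_pos).ne'
  have h : EqOn (fun t => gammaDensity a r t * gammaDensity (a + 1) r t)
      (fun t => r ^ a / Gamma a * (r ^ (a + 1) / Gamma (a + 1)) *
        (t ^ (2 * a - 1) * exp (-(2 * r * t)))) (Ioi 0) := fun t (ht : 0 < t) => by
    simp only [gammaDensity]
    rw [show 2 * a - 1 = (a - 1) + (a + 1 - 1) by ring, rpow_add ht,
      show -(2 * r * t) = -(r * t) + -(r * t) by ring, exp_add]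
    ring
  have hdup := Gamma_mul_Gamma_add_half a
  rw [show 1 - 2 * a = 1 - a - a by ring, rpow_sub two_pos, rpow_sub two_pos, rpow_one] at hdup
  rw [setIntegral_congr_fun measurableSet_Ioi h, integral_const_mul,
    integral_rpow_mul_exp_neg_mul_Ioi (by linarith) (by linarith), div_rpow zero_le_one (by linarith),
    one_rpow, mul_rpow zero_le_two hr.le, rpow_add_one hr.ne', two_mul a,
    rpow_add two_pos, rpow_add hr, ← two_mul a]
  field_simp at hdup ⊢
  linear_combination -hdup

lemma integral_min_inv_prod_gammaMeasure {a r : ℝ} (ha : 1 ≤ a) (hr : 0 < r) :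
    ∫ z : ℝ × ℝ, min z.1⁻¹ z.2⁻¹ ∂(gammaMeasure (a + 1) r).prod (gammaMeasure (a + 1) r) =
      r / a * (1 - (√π)⁻¹ * (Gamma (a + 1 / 2) / Gamma (a + 1))) := by
  have ha0 : 0 < a := by linarith
  have ha1 : 0 < a + 1 := by linarith
  have := isProbabilityMeasure_gammaMeasure ha1 hr
  have hqp := setIntegral_gammaDensity_mul_gammaDensity_add_one ha0 hr
  have hqp_int : IntegrableOn (fun t => gammaDensity a r t * gammaDensity (a + 1) r t) (Ioi 0) :=
    not_imp_comm.1 integral_undef (by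
      rw [hqp]
      have := Gamma_pos_of_pos ha1
      have := Gamma_pos_of_pos (show 0 < a + 1 / 2 by linarith)
      positivity)
  set H : ℝ → ℝ := fun t => gammaDistFun a r t * gammaDistFun a r t + gammaDistFun (a + 1) r t -
    gammaDistFun (a + 1) r t * gammaDistFun a r t with hH
  set H' : ℝ → ℝ := fun t => gammaDensity a r t *
    (gammaDistFun a r t + gammaDensity (a + 1) r t / r) +
      gammaDensity (a + 1) r t * (1 - gammaDistFun a r t) with hH'
  have hderiv (t : ℝ) : HasDerivAt H (H' t) t := by
    have hG := hasDerivAt_gammaDistFun ha r t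
    have hP := hasDerivAt_gammaDistFun (show 1 ≤ a + 1 by linarith) r t
    refine (((hG.mul hG).add hP).sub (hP.mul hG)).congr_deriv ?_
    simp only [hH', gammaDistFun_add_one ha hr]
    ring
  have hnonneg : ∀ t ∈ Ioi (0 : ℝ), 0 ≤ H' t := fun t (ht : 0 < t) => by
    have h₁ := gammaDensity_nonneg ha0 hr ht.le
    have h₂ := gammaDensity_nonneg ha1 hr ht.le
    have h₃ := gammaDistFun_nonneg ha0 hr ht.le
    have h₄ := sub_nonneg.2 (gammaDistFun_le_one ha0 hr ht.le)
    simp only [hH']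
    positivity
  have hlim : Tendsto H atTop (𝓝 1) := by
    have hG := tendsto_gammaDistFun_atTop ha0 hr
    have hP := tendsto_gammaDistFun_atTop ha1 hr
    simpa using ((hG.mul hG).add hP).sub (hP.mul hG)
  have hH0 : H 0 = 0 := by simp [hH, gammaDistFun]
  have hint := integral_Ioi_of_hasDerivAt_of_nonneg' (fun t _ => hderiv t) hnonneg hlim
  have hint' := integrableOn_Ioi_deriv_of_nonneg
    (hderiv 0).continuousAt.continuousWithinAt (fun t _ => hderiv t) hnonneg hlim
  have hcongr : EqOn
      (fun u => gammaDensity (a + 1) r u * ∫ v, min u⁻¹ v⁻¹ ∂gammaMeasure (a + 1) r)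
      (fun u => r / a * (H' u - 2 / r * (gammaDensity a r u * gammaDensity (a + 1) r u)))
      (Ioi 0) := fun u (hu : 0 < u) => by
    simp only [hH', integral_min_inv_gammaMeasure_add_one ha hr hu, gammaDistFun_add_one ha hr,
      gammaDensity_add_one ha0 hr hu]
    field_simp
    ring
  rw [integral_prod _ (integrable_min_inv_prod_gammaMeasure ha0 hr), integral_gammaMeasure ha1 hr,
    setIntegral_congr_fun measurableSet_Ioi hcongr, integral_const_mul,
    integral_sub hint' (hqp_int.const_mul _), integral_const_mul, hint, hqp, hH0]
  field_simp
  ring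

/-- The logarithmic convexity of `Γ` at a midpoint. -/
lemma sq_Gamma_add_half_le {s : ℝ} (hs : 0 < s) :
    Gamma (s + 1 / 2) ^ 2 ≤ Gamma s * Gamma (s + 1) := by
  have hG := Gamma_pos_of_pos hs
  have hG' := Gamma_pos_of_pos (show 0 < s + 1 by linarith)
  have h := Gamma_mul_add_mul_le_rpow_Gamma_mul_rpow_Gamma hs (show 0 < s + 1 by linarith)
    (one_half_pos (α := ℝ)) (one_half_pos (α := ℝ)) (by norm_num)
  rw [show 1 / 2 * s + 1 / 2 * (s + 1) = s + 1 / 2 by ring, ← mul_rpow hG.le hG'.le,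
    ← sqrt_eq_rpow] at h
  exact (le_sqrt (Gamma_pos_of_pos (by linarith)).le (by positivity)).1 h

lemma abs_Gamma_add_half_div_sub_le {a : ℝ} (ha : 0 < a) :
    |Gamma (a + 1 / 2) / Gamma (a + 1) - (√a)⁻¹| ≤ (√a)⁻¹ * a⁻¹ := by
  have h₁ := sq_Gamma_add_half_le ha
  have h₂ := sq_Gamma_add_half_le (show 0 < a + 1 / 2 by linarith)
  rw [show a + 1 / 2 + 1 / 2 = a + 1 by ring, Gamma_add_one (by linarith : a + 1 / 2 ≠ 0)] at h₂
  have hG₁ := Gamma_pos_of_pos (show 0 < a + 1 by linarith)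
  have hG₂ := Gamma_pos_of_pos (show 0 < a + 1 / 2 by linarith)
  have hsa := sqrt_pos.2 ha
  have hsq := sq_sqrt ha.le
  have hrec := Gamma_add_one ha.ne'
  set ρ := Gamma (a + 1 / 2) / Gamma (a + 1) * √a with hρ
  have hρ0 : 0 < ρ := by positivity
  have hρ2 : ρ ^ 2 = Gamma (a + 1 / 2) ^ 2 * a / Gamma (a + 1) ^ 2 := by
    rw [hρ, mul_pow, div_pow, hsq]; ring
  have hle : ρ ^ 2 ≤ 1 := by
    rw [hρ2, div_le_one (by positivity)]
    nlinarith
  have hge : 1 ≤ ρ ^ 2 * (1 + a⁻¹) := by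
    have hexp : Gamma (a + 1 / 2) ^ 2 * a * (1 + a⁻¹) = Gamma (a + 1 / 2) ^ 2 * (a + 1) := by
      rw [mul_assoc, mul_add, mul_inv_cancel₀ ha.ne', mul_one]
    rw [hρ2, div_mul_eq_mul_div, one_le_div (by positivity), hexp]
    nlinarith [sq_nonneg (Gamma (a + 1 / 2))]
  have hρ1 : ρ ≤ 1 := by nlinarith
  have hdiff : 1 - ρ ≤ a⁻¹ := by
    have : 0 < a⁻¹ := inv_pos.2 ha
    nlinarith
  have heq : Gamma (a + 1 / 2) / Gamma (a + 1) - (√a)⁻¹ = -((√a)⁻¹ * (1 - ρ)) := by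
    rw [hρ]; field_simp; ring
  rw [heq, abs_neg, abs_of_nonneg (mul_nonneg (by positivity) (by linarith))]
  gcongr

/-- If, for each `0 < b < 1`, `X b` and `Y b` are i.i.d. InverseGamma(shape `b⁻¹ + 1`,
scale `x⁻¹ b`) random variables (i.e. their reciprocals are Gamma with shape `b⁻¹ + 1` and
rate `(x⁻¹ b)⁻¹ = x b⁻¹`), then `E[min{X,Y} − x] = −(x/√π) Γ(b⁻¹+1/2)/Γ(b⁻¹+1)`, and as
`b → 0⁺` this equals `−x √(b/π) + O_x(b^(3/2))`. -/
theorem min_invGamma_kernel_first_moment_asymp {Ω : Type*} [MeasureSpace Ω]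
    [IsProbabilityMeasure (ℙ : Measure Ω)]
    (x : ℝ) (hx : 0 < x) (X Y : ℝ → Ω → ℝ)
    (hX : ∀ b, 0 < b → b < 1 →
      Measure.map (fun ω => (X b ω)⁻¹) ℙ = gammaMeasure (b⁻¹ + 1) (x * b⁻¹))
    (hY : ∀ b, 0 < b → b < 1 →
      Measure.map (fun ω => (Y b ω)⁻¹) ℙ = gammaMeasure (b⁻¹ + 1) (x * b⁻¹))
    (hindep : ∀ b, 0 < b → b < 1 → IndepFun (X b) (Y b) ℙ) :
    (∀ b, 0 < b → b < 1 →
      ∫ ω, (min (X b ω) (Y b ω) - x) ∂ℙ =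
        -(x / Real.sqrt π) * (Real.Gamma (b⁻¹ + 1/2) / Real.Gamma (b⁻¹ + 1))) ∧
    ∃ C b₀ : ℝ, 0 < C ∧ 0 < b₀ ∧ ∀ b, 0 < b → b < b₀ → b < 1 →
      |(∫ ω, (min (X b ω) (Y b ω) - x) ∂ℙ) - (-(x * Real.sqrt (b / π)))|
        ≤ C * b ^ ((3 : ℝ) / 2) := by
  have hmean : ∀ b, 0 < b → b < 1 →
      ∫ ω, (min (X b ω) (Y b ω) - x) ∂ℙ =
        -(x / Real.sqrt π) * (Real.Gamma (b⁻¹ + 1/2) / Real.Gamma (b⁻¹ + 1)) := by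
    intro b hb hb1
    have ha : 1 ≤ b⁻¹ := (one_lt_inv₀ hb).2 hb1 |>.le
    have ha0 : 0 < b⁻¹ := by linarith
    have hr : 0 < x * b⁻¹ := by positivity
    have := isProbabilityMeasure_gammaMeasure (a := b⁻¹ + 1) (by linarith) hr
    have hXm : AEMeasurable (fun ω => (X b ω)⁻¹) ℙ :=
      .of_map_ne_zero (by rw [hX b hb hb1]; exact IsProbabilityMeasure.ne_zero _)
    have hYm : AEMeasurable (fun ω => (Y b ω)⁻¹) ℙ :=
      .of_map_ne_zero (by rw [hY b hb hb1]; exact IsProbabilityMeasure.ne_zero _)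
    have hmap := ((hindep b hb hb1).comp measurable_inv measurable_inv).map_prod_eq_prod_map_map
      hXm hYm
    change Measure.map (fun ω => ((X b ω)⁻¹, (Y b ω)⁻¹)) ℙ =
      (Measure.map (fun ω => (X b ω)⁻¹) ℙ).prod (Measure.map (fun ω => (Y b ω)⁻¹) ℙ) at hmap
    rw [hX b hb hb1, hY b hb hb1] at hmap
    have hint := integrable_min_inv_prod_gammaMeasure ha0 hr
    have hval := integral_min_inv_prod_gammaMeasure ha hr
    rw [← hmap] at hint hval
    rw [integral_map (hXm.prodMk hYm) hint.aestronglyMeasurable] at hval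
    replace hint := (integrable_map_measure hint.aestronglyMeasurable (hXm.prodMk hYm)).1 hint
    simp only [inv_inv, Function.comp_def] at hint hval
    rw [integral_sub hint (integrable_const x), hval, integral_const, probReal_univ, one_smul]
    field_simp
    ring
  refine ⟨hmean, x / √π, 1, by positivity, one_pos, fun b hb hb1 _ => ?_⟩
  have hbound := abs_Gamma_add_half_div_sub_le (inv_pos.2 hb)
  rw [sqrt_inv, inv_inv, inv_inv] at hbound
  rw [hmean b hb hb1, sqrt_div hb.le,
    show (3 : ℝ) / 2 = 1 / 2 + 1 by norm_num, rpow_add_one hb.ne', ← sqrt_eq_rpow,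
    show -(x / √π) * (Gamma (b⁻¹ + 1 / 2) / Gamma (b⁻¹ + 1)) - -(x * (√b / √π)) =
      -(x / √π * (Gamma (b⁻¹ + 1 / 2) / Gamma (b⁻¹ + 1) - √b)) by ring,
    abs_neg, abs_mul, abs_of_pos (show 0 < x / √π by positivity)]
  gcongr
end

section
/- If X, Y are i.i.d. InverseGamma(b^(−1) + 1, x^(−1) b) random variables with fixed x > 0 and 0 < b < 1, then E[(min{X,Y} − x)²] = bx² + O_x(b^(3/2)) as b → 0⁺. -/
open MeasureTheory ProbabilityTheory Real

lemma Real.measurable_sign : Measurable Real.sign := by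
  unfold Real.sign
  exact Measurable.ite measurableSet_Iio measurable_const
    (Measurable.ite measurableSet_Ioi measurable_const measurable_const)

lemma Real.sign_mul_self_eq_abs (t : ℝ) : Real.sign t * t = |t| := by
  rcases lt_trichotomy t 0 with h | rfl | h
  · simp [Real.sign_of_neg h, abs_of_neg h]
  · simp
  · simp [Real.sign_of_pos h, abs_of_pos h]

lemma Real.abs_sign_le_one (t : ℝ) : |Real.sign t| ≤ 1 := by
  rcases Real.sign_apply_eq t with h | h | h <;> simp [h]

lemma integrableOn_rpow_mul_exp_neg_mul {s r : ℝ} (hs : -1 < s) (hr : 0 < r) :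
    IntegrableOn (fun g : ℝ => g ^ s * exp (-(r * g))) (Set.Ioi 0) := by
  simpa using integrableOn_rpow_mul_exp_neg_mul_rpow (p := 1) hs one_pos hr

/-- The function `g ↦ (A g^(a-2) + B g^(a-1)) e^(-rg)` vanishes at infinity, so the integral of its
derivative over `(c, ∞)` vanishes as soon as it vanishes at `c`. -/
lemma setIntegral_Ioi_deriv_gamma_weight_eq_zero {a r c A B : ℝ} (ha : 2 < a) (hr : 0 < r)
    (hc : 0 ≤ c) (hzero : A * c ^ (a - 2) + B * c ^ (a - 1) = 0) :
    ∫ g in Set.Ioi c, g ^ (a - 1) * exp (-(r * g)) *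
      (((a - 1) * g⁻¹ - r) * (A * g⁻¹ + B) - A * (g⁻¹) ^ 2) = 0 := by
  have hderiv : ∀ g ∈ Set.Ioi c,
      HasDerivAt (fun g : ℝ => (A * g ^ (a - 2) + B * g ^ (a - 1)) * exp (-(r * g)))
        (A * (a - 2) * (g ^ (a - 3) * exp (-(r * g)))
          + (B * (a - 1) - r * A) * (g ^ (a - 2) * exp (-(r * g)))
          - r * B * (g ^ (a - 1) * exp (-(r * g)))) g := by
    intro g hg
    have hg0 : g ≠ 0 := (hc.trans_lt hg).ne'
    have h1 := (Real.hasDerivAt_rpow_const (p := a - 2) (Or.inl hg0)).const_mul A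
    have h2 := (Real.hasDerivAt_rpow_const (p := a - 1) (Or.inl hg0)).const_mul B
    have h3 := ((hasDerivAt_id g).const_mul r).neg.exp
    refine ((h1.add h2).mul h3).congr_deriv ?_
    simp only [id, Pi.add_apply, Pi.neg_apply]
    rw [show a - 2 - 1 = a - 3 by ring, show a - 1 - 1 = a - 2 by ring]
    ring
  have hint : IntegrableOn (fun g : ℝ => A * (a - 2) * (g ^ (a - 3) * exp (-(r * g)))
      + (B * (a - 1) - r * A) * (g ^ (a - 2) * exp (-(r * g)))
      - r * B * (g ^ (a - 1) * exp (-(r * g)))) (Set.Ioi c) := by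
    refine IntegrableOn.mono_set ?_ (Set.Ioi_subset_Ioi hc)
    exact (((integrableOn_rpow_mul_exp_neg_mul (by linarith) hr).const_mul _).add
      ((integrableOn_rpow_mul_exp_neg_mul (by linarith) hr).const_mul _)).sub
      ((integrableOn_rpow_mul_exp_neg_mul (by linarith) hr).const_mul _)
  have hlim : Filter.Tendsto
      (fun g : ℝ => (A * g ^ (a - 2) + B * g ^ (a - 1)) * exp (-(r * g)))
      Filter.atTop (nhds 0) := by
    have h := ((tendsto_rpow_mul_exp_neg_mul_atTop_nhds_zero (a - 2) r hr).const_mul A).add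
      ((tendsto_rpow_mul_exp_neg_mul_atTop_nhds_zero (a - 1) r hr).const_mul B)
    simp only [mul_zero, add_zero] at h
    refine h.congr fun g => ?_
    rw [neg_mul]
    ring
  have hcont : Continuous
      (fun g : ℝ => (A * g ^ (a - 2) + B * g ^ (a - 1)) * exp (-(r * g))) := by
    have h1 := Real.continuous_rpow_const (q := a - 2) (by linarith)
    have h2 := Real.continuous_rpow_const (q := a - 1) (by linarith)
    fun_prop
  have key := integral_Ioi_of_hasDerivAt_of_tendsto hcont.continuousWithinAt hderiv hint hlim
  rw [hzero, zero_mul, sub_zero] at key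
  rw [← key]
  refine setIntegral_congr_fun measurableSet_Ioi fun g hg => ?_
  have hg0 : 0 < g := hc.trans_lt hg
  have e1 : g ^ (a - 2) = g ^ (a - 1) * g⁻¹ := by
    rw [show a - 2 = a - 1 - 1 by ring, Real.rpow_sub_one hg0.ne', div_eq_mul_inv]
  have e2 : g ^ (a - 3) = g ^ (a - 1) * (g⁻¹) ^ 2 := by
    rw [show a - 3 = a - 2 - 1 by ring, Real.rpow_sub_one hg0.ne', e1, div_eq_mul_inv]
    ring
  simp only [e1, e2]
  ring

lemma gammaPDFReal_smul_eq_indicator {a r : ℝ} (ha : 2 < a) (f : ℝ → ℝ) (g : ℝ) :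
    gammaPDFReal a r g • f g = (Set.Ioi (0 : ℝ)).indicator
      (fun g => r ^ a / Gamma a * (g ^ (a - 1) * exp (-(r * g)) * f g)) g := by
  rcases lt_trichotomy g 0 with h | rfl | h
  · simp [gammaPDFReal, h.not_ge, h.le]
  · simp [gammaPDFReal, Real.zero_rpow (show a - 1 ≠ 0 by linarith)]
  · simp only [gammaPDFReal, h.le, if_true, smul_eq_mul, Set.mem_Ioi, h, Set.indicator_of_mem]
    ring

lemma toReal_gammaPDF {a r : ℝ} (ha : 0 < a) (hr : 0 < r) (g : ℝ) :
    (gammaPDF a r g).toReal = gammaPDFReal a r g :=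
  ENNReal.toReal_ofReal (gammaPDFReal_nonneg ha hr g)

lemma measurable_gammaPDF (a r : ℝ) : Measurable (gammaPDF a r) :=
  (measurable_gammaPDFReal a r).ennreal_ofReal

lemma integral_gammaMeasure_s13 {a r : ℝ} (ha : 2 < a) (hr : 0 < r) (f : ℝ → ℝ) :
    ∫ g, f g ∂(gammaMeasure a r) =
      r ^ a / Gamma a * ∫ g in Set.Ioi 0, g ^ (a - 1) * exp (-(r * g)) * f g := by
  rw [gammaMeasure, integral_withDensity_eq_integral_toReal_smul (measurable_gammaPDF a r)
    (ae_of_all _ fun _ => ENNReal.ofReal_lt_top)]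
  simp_rw [toReal_gammaPDF (show 0 < a by linarith) hr, gammaPDFReal_smul_eq_indicator ha f]
  rw [integral_indicator measurableSet_Ioi, integral_const_mul]

lemma integrable_gammaMeasure {a r : ℝ} (ha : 2 < a) (hr : 0 < r) {f : ℝ → ℝ}
    (hf : IntegrableOn (fun g => g ^ (a - 1) * exp (-(r * g)) * f g) (Set.Ioi 0)) :
    Integrable f (gammaMeasure a r) := by
  rw [gammaMeasure, integrable_withDensity_iff_integrable_smul' (measurable_gammaPDF a r)
    (ae_of_all _ fun _ => ENNReal.ofReal_lt_top)]
  simp_rw [toReal_gammaPDF (show 0 < a by linarith) hr, gammaPDFReal_smul_eq_indicator ha f]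
  rw [integrable_indicator_iff measurableSet_Ioi]
  exact hf.const_mul _

lemma ae_pos_gammaMeasure_s13 {a r : ℝ} (ha : 2 < a) : ∀ᵐ g ∂(gammaMeasure a r), 0 < g := by
  rw [gammaMeasure, ae_withDensity_iff (measurable_gammaPDF a r)]
  refine ae_of_all _ fun g hg => ?_
  by_contra h
  refine hg ?_
  have := gammaPDFReal_smul_eq_indicator (r := r) ha (fun _ => 1) g
  rw [Set.indicator_of_notMem (by simpa using h), smul_eq_mul, mul_one] at this
  rw [gammaPDF, this, ENNReal.ofReal_zero]

lemma integrable_inv_pow_two_gammaMeasure {a r : ℝ} (ha : 2 < a) (hr : 0 < r) :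
    Integrable (fun g => (g⁻¹) ^ 2) (gammaMeasure a r) := by
  refine integrable_gammaMeasure ha hr ?_
  refine (integrableOn_rpow_mul_exp_neg_mul (s := a - 3) (by linarith) hr).congr_fun
    (fun g hg => ?_) measurableSet_Ioi
  have hg0 : g ≠ 0 := (show (0 : ℝ) < g from hg).ne'
  simp only [show a - 3 = a - 1 - 1 - 1 by ring, Real.rpow_sub_one hg0, div_eq_mul_inv]
  ring

lemma integral_gammaMeasure_deriv_eq_zero {a r A B : ℝ} (ha : 2 < a) (hr : 0 < r) :
    ∫ g, (((a - 1) * g⁻¹ - r) * (A * g⁻¹ + B) - A * (g⁻¹) ^ 2) ∂(gammaMeasure a r) = 0 := by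
  rw [integral_gammaMeasure_s13 ha hr, setIntegral_Ioi_deriv_gamma_weight_eq_zero ha hr le_rfl,
    mul_zero]
  simp [Real.zero_rpow (show a - 2 ≠ 0 by linarith), Real.zero_rpow (show a - 1 ≠ 0 by linarith)]

lemma integral_gammaMeasure_sign_deriv_eq_zero {a r y : ℝ} (ha : 2 < a) (hr : 0 < r)
    (hy : 0 < y) :
    ∫ g, Real.sign (g⁻¹ - y) * (((a - 1) * g⁻¹ - r) * (g⁻¹ - y) - (g⁻¹) ^ 2)
      ∂(gammaMeasure a r) = 0 := by
  have hc : 0 < y⁻¹ := inv_pos.2 hy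
  set F : ℝ → ℝ := fun g => g ^ (a - 1) * exp (-(r * g)) *
    (((a - 1) * g⁻¹ - r) * (1 * g⁻¹ + (-y)) - 1 * (g⁻¹) ^ 2) with hF
  have h0 : ∫ g in Set.Ioi 0, F g = 0 := by
    apply setIntegral_Ioi_deriv_gamma_weight_eq_zero ha hr le_rfl
    simp [Real.zero_rpow (show a - 2 ≠ 0 by linarith),
      Real.zero_rpow (show a - 1 ≠ 0 by linarith)]
  have h1 : ∫ g in Set.Ioi y⁻¹, F g = 0 := by
    apply setIntegral_Ioi_deriv_gamma_weight_eq_zero ha hr hc.le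
    rw [show a - 2 = a - 1 - 1 by ring, Real.rpow_sub_one hc.ne']
    field_simp
    ring
  have hFint : IntegrableOn F (Set.Ioi 0) := by
    have h3 := integrableOn_rpow_mul_exp_neg_mul (s := a - 3) (by linarith) hr
    have h2 := integrableOn_rpow_mul_exp_neg_mul (s := a - 2) (by linarith) hr
    have h1 := integrableOn_rpow_mul_exp_neg_mul (s := a - 1) (by linarith) hr
    refine IntegrableOn.congr_fun ((h3.const_mul (a - 2)).add ((h2.const_mul
      (-(a - 1) * y - r)).add (h1.const_mul (r * y)))) (fun g hg => ?_) measurableSet_Ioi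
    have hg0 : g ≠ 0 := (show (0 : ℝ) < g from hg).ne'
    simp only [hF, Pi.add_apply, show a - 3 = a - 1 - 1 - 1 by ring,
      show a - 2 = a - 1 - 1 by ring, Real.rpow_sub_one hg0, div_eq_mul_inv]
    ring
  have hunion : Set.Ioc 0 y⁻¹ ∪ Set.Ioi y⁻¹ = Set.Ioi 0 := Set.Ioc_union_Ioi_eq_Ioi hc.le
  have hdisj : Disjoint (Set.Ioc 0 y⁻¹) (Set.Ioi y⁻¹) := Set.Ioc_disjoint_Ioi le_rfl
  have hFl : IntegrableOn F (Set.Ioc 0 y⁻¹) := hFint.mono_set Set.Ioc_subset_Ioi_self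
  have hFr : IntegrableOn F (Set.Ioi y⁻¹) := hFint.mono_set (Set.Ioi_subset_Ioi hc.le)
  have h2 : ∫ g in Set.Ioc 0 y⁻¹, F g = 0 := by
    rw [← hunion, setIntegral_union hdisj measurableSet_Ioi hFl hFr, h1, add_zero] at h0
    exact h0
  rw [integral_gammaMeasure_s13 ha hr]
  have hl : ∀ g ∈ Set.Ioo 0 y⁻¹, F g = g ^ (a - 1) * exp (-(r * g)) *
      (Real.sign (g⁻¹ - y) * (((a - 1) * g⁻¹ - r) * (g⁻¹ - y) - (g⁻¹) ^ 2)) := by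
    intro g hg
    have : y < g⁻¹ := (lt_inv_comm₀ hg.1 hy).1 hg.2
    rw [Real.sign_of_pos (by linarith), hF]
    ring
  have hr' : ∀ g ∈ Set.Ioi y⁻¹, -F g = g ^ (a - 1) * exp (-(r * g)) *
      (Real.sign (g⁻¹ - y) * (((a - 1) * g⁻¹ - r) * (g⁻¹ - y) - (g⁻¹) ^ 2)) := by
    intro g hg
    have : g⁻¹ < y := (inv_lt_comm₀ hy (hc.trans hg)).1 hg
    rw [Real.sign_of_neg (by linarith), hF]
    ring
  rw [← hunion, setIntegral_union hdisj measurableSet_Ioi, integral_Ioc_eq_integral_Ioo,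
    ← setIntegral_congr_fun measurableSet_Ioo hl, ← setIntegral_congr_fun measurableSet_Ioi hr',
    integral_neg, h1, ← integral_Ioc_eq_integral_Ioo, h2]
  · simp
  · rw [integrableOn_Ioc_iff_integrableOn_Ioo]
    exact (hFint.mono_set Set.Ioo_subset_Ioi_self).congr_fun hl measurableSet_Ioo
  · exact hFr.neg.congr_fun hr' measurableSet_Ioi

/-- For a probability measure `ν` with mean `x` whose Stein identity
`E[(T - x) f(T)] = b E[T² (deriv f)(T)]` holds for the functions `f = |· - y|`, the second moment of
`min - x` for two independent copies is `b x² + O(b^(3/2))`. -/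
lemma abs_integral_min_sub_sq_le_of_stein {ν : Measure ℝ} [IsProbabilityMeasure ν] {x b : ℝ}
    (hx : 0 < x) (hb : 0 < b) (hb2 : b < 1 / 2) (hL : MemLp (fun t : ℝ => t) 2 ν)
    (hmean : ∫ t, t ∂ν = x) (hsq : (1 - b) * ∫ t, t ^ 2 ∂ν = x ^ 2)
    (hstein : ∀ᵐ y ∂ν, ∫ t, Real.sign (t - y) * ((t - x) * (t - y) - b * t ^ 2) ∂ν = 0) :
    |(∫ p, (min p.1 p.2 - x) ^ 2 ∂(ν.prod ν)) - b * x ^ 2|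
      ≤ (2 * x ^ 2 + 2 * x * (2 * x ^ 2 + 1)) * b ^ ((3 : ℝ) / 2) := by
  have h1b : 0 < 1 - b := by linarith
  have hvar : ∫ t, (t - x) ^ 2 ∂ν = x ^ 2 * b / (1 - b) := by
    have h1 : Integrable (fun t : ℝ => t) ν := hL.integrable one_le_two
    have h2 : Integrable (fun t : ℝ => t ^ 2) ν := hL.integrable_sq
    have h : (fun t : ℝ => (t - x) ^ 2) = fun t => t ^ 2 - 2 * x * t + x ^ 2 := by
      ext t; ring
    have h21 : Integrable (fun t : ℝ => t ^ 2 - 2 * x * t) ν := h2.sub (h1.const_mul _)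
    rw [h, integral_add h21 (integrable_const _),
      integral_sub h2 (h1.const_mul _), integral_const_mul, hmean, integral_const,
      eq_div_iff h1b.ne']
    simp only [probReal_univ, smul_eq_mul]
    linear_combination hsq
  have hs : MemLp (fun p : ℝ × ℝ => p.1) 2 (ν.prod ν) :=
    hL.comp_measurePreserving measurePreserving_fst
  have ht : MemLp (fun p : ℝ × ℝ => p.2) 2 (ν.prod ν) :=
    hL.comp_measurePreserving measurePreserving_snd
  have hd : MemLp (fun p : ℝ × ℝ => |p.1 - p.2|) 2 (ν.prod ν) := (hs.sub ht).abs
  have hU : Integrable (fun p : ℝ × ℝ => (p.1 - x) ^ 2) (ν.prod ν) :=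
    (hs.sub (memLp_const x)).integrable_sq
  have hV : Integrable (fun p : ℝ × ℝ => (p.2 - x) ^ 2) (ν.prod ν) :=
    (ht.sub (memLp_const x)).integrable_sq
  have hUint : ∫ p, (p.1 - x) ^ 2 ∂(ν.prod ν) = x ^ 2 * b / (1 - b) := by
    rw [← hvar]
    simpa using integral_fun_fst (μ := ν) (ν := ν) (fun t : ℝ => (t - x) ^ 2)
  have hVint : ∫ p, (p.2 - x) ^ 2 ∂(ν.prod ν) = x ^ 2 * b / (1 - b) := by
    rw [← hvar]
    simpa using integral_fun_snd (μ := ν) (ν := ν) (fun t : ℝ => (t - x) ^ 2)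
  have hN : Integrable (fun p : ℝ × ℝ => |p.1 - p.2|) (ν.prod ν) := hd.integrable one_le_two
  have hM : Integrable (fun p : ℝ × ℝ => |p.1 - p.2| * (p.1 + p.2)) (ν.prod ν) :=
    hd.integrable_mul (hs.add ht)
  set ψ : ℝ × ℝ → ℝ := fun p =>
    Real.sign (p.1 - p.2) * ((p.1 - x) * (p.1 - p.2) - b * p.1 ^ 2) with hψdef
  have hψ : Integrable ψ (ν.prod ν) := by
    have h : Integrable (fun p : ℝ × ℝ => (p.1 - x) * (p.1 - p.2) - b * p.1 ^ 2) (ν.prod ν) :=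
      ((hs.sub (memLp_const x)).integrable_mul (hs.sub ht)).sub (hs.integrable_sq.const_mul b)
    refine h.bdd_mul (c := 1) ?_ (ae_of_all _ fun p => ?_)
    · exact (Real.measurable_sign.comp (measurable_fst.sub measurable_snd)).aestronglyMeasurable
    · exact Real.abs_sign_le_one _
  have hψ0 : ∫ p, ψ p ∂(ν.prod ν) = 0 := by
    rw [integral_prod_symm ψ hψ]
    exact integral_eq_zero_of_ae hstein
  have hψ0' : ∫ p, ψ p.swap ∂(ν.prod ν) = 0 := by rw [integral_prod_swap ψ, hψ0]
  have hψsum : ∀ p, ψ p + ψ p.swap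
      = (1 - b) * (|p.1 - p.2| * (p.1 + p.2)) - 2 * x * |p.1 - p.2| := by
    intro p
    have hneg : Real.sign (p.2 - p.1) = -Real.sign (p.1 - p.2) := by
      rw [← Real.sign_neg, neg_sub]
    simp only [hψdef, Prod.fst_swap, Prod.snd_swap, hneg, ← Real.sign_mul_self_eq_abs]
    ring
  have hMN : (1 - b) * ∫ p, |p.1 - p.2| * (p.1 + p.2) ∂(ν.prod ν)
      = 2 * x * ∫ p, |p.1 - p.2| ∂(ν.prod ν) := by
    have h : ∫ p, (ψ p + ψ p.swap) ∂(ν.prod ν) = 0 := by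
      have hψs : Integrable (fun p => ψ p.swap) (ν.prod ν) := hψ.swap
      rw [integral_add hψ hψs, hψ0, hψ0', add_zero]
    simp_rw [hψsum] at h
    rw [integral_sub (hM.const_mul _) (hN.const_mul _), integral_const_mul,
      integral_const_mul] at h
    linarith
  have hmin : ∀ p : ℝ × ℝ, (min p.1 p.2 - x) ^ 2 = 1 / 2 * (p.1 - x) ^ 2 + 1 / 2 * (p.2 - x) ^ 2
      - (1 / 2 * (|p.1 - p.2| * (p.1 + p.2)) - x * |p.1 - p.2|) := by
    intro p
    rcases le_total p.1 p.2 with h | h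
    · rw [min_eq_left h, abs_of_nonpos (by linarith)]; ring
    · rw [min_eq_right h, abs_of_nonneg (by linarith)]; ring
  simp_rw [hmin]
  have hUV : ∀ k : ℝ, Integrable (fun p : ℝ × ℝ => k * (p.1 - x) ^ 2 + k * (p.2 - x) ^ 2)
      (ν.prod ν) := fun k => (hU.const_mul k).add (hV.const_mul k)
  have hMN' : Integrable (fun p : ℝ × ℝ => 1 / 2 * (|p.1 - p.2| * (p.1 + p.2))
      - x * |p.1 - p.2|) (ν.prod ν) := (hM.const_mul _).sub (hN.const_mul _)
  rw [integral_sub (hUV _) hMN',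
    integral_add (hU.const_mul _) (hV.const_mul _), integral_sub (hM.const_mul _) (hN.const_mul _)]
  simp only [integral_const_mul, hUint, hVint]
  have hsb : 0 < √b := Real.sqrt_pos.2 hb
  have hsb2 : √b ^ 2 = b := Real.sq_sqrt hb.le
  have hsb1 : √b ≤ 1 := Real.sqrt_le_one.2 (by linarith)
  have hNle : ∫ p, |p.1 - p.2| ∂(ν.prod ν) ≤ (2 * x ^ 2 + 1) * √b := by
    have hle : ∀ p : ℝ × ℝ, |p.1 - p.2| ≤
        1 / (2 * √b) * (p.1 - x) ^ 2 + 1 / (2 * √b) * (p.2 - x) ^ 2 + √b := by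
      intro p
      have hone : ∀ u : ℝ, |u| ≤ 1 / (2 * √b) * u ^ 2 + √b / 2 := by
        intro u
        have : 1 / (2 * √b) * u ^ 2 + √b / 2 - |u| = (|u| - √b) ^ 2 / (2 * √b) := by
          field_simp
          rw [sub_sq, sq_abs]
          ring
        have : 0 ≤ (|u| - √b) ^ 2 / (2 * √b) := by positivity
        linarith
      have h := abs_sub (p.1 - x) (p.2 - x)
      rw [sub_sub_sub_cancel_right] at h
      linarith [hone (p.1 - x), hone (p.2 - x)]
    have h := integral_mono hN ((hUV _).add (integrable_const _)) hle
    refine h.trans ?_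
    simp only [Pi.add_apply]
    rw [integral_add (hUV _) (integrable_const _),
      integral_add (hU.const_mul _) (hV.const_mul _), integral_const_mul, integral_const_mul,
      hUint, hVint, integral_const]
    simp only [probReal_univ, smul_eq_mul, one_mul]
    have : x ^ 2 * b / (1 - b) ≤ 2 * x ^ 2 * b := by
      rw [div_le_iff₀ h1b]
      have : 0 ≤ x ^ 2 * b * (1 - 2 * b) := by
        have : 0 ≤ 1 - 2 * b := by linarith
        positivity
      nlinarith
    calc _ = 1 / √b * (x ^ 2 * b / (1 - b)) + √b := by field_simp; ring
      _ ≤ 1 / √b * (2 * x ^ 2 * b) + √b := by gcongr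
      _ = (2 * x ^ 2 + 1) * √b := by
        nth_rewrite 2 [← hsb2]
        field_simp
  have hN0 : 0 ≤ ∫ p, |p.1 - p.2| ∂(ν.prod ν) := integral_nonneg fun p => abs_nonneg _
  have hpow : b ^ ((3 : ℝ) / 2) = b * √b := by
    rw [Real.sqrt_eq_rpow, show (3 : ℝ) / 2 = 1 + 1 / 2 by norm_num, Real.rpow_add hb,
      Real.rpow_one]
  rw [hpow]
  set M := ∫ p, |p.1 - p.2| * (p.1 + p.2) ∂(ν.prod ν)
  set N := ∫ p, |p.1 - p.2| ∂(ν.prod ν)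
  have hMeq : M = 2 * x * N / (1 - b) := by
    rw [eq_div_iff h1b.ne']; linarith
  have hval : 1 / 2 * (x ^ 2 * b / (1 - b)) + 1 / 2 * (x ^ 2 * b / (1 - b))
      - (1 / 2 * M - x * N) - b * x ^ 2 = b / (1 - b) * (x ^ 2 * b) - b / (1 - b) * (x * N) := by
    rw [hMeq]
    field_simp
    ring
  have hq : b / (1 - b) ≤ 2 * b := by
    rw [div_le_iff₀ h1b]; nlinarith
  have hq0 : 0 ≤ b / (1 - b) := by positivity
  have hbs : b ≤ √b := by nlinarith
  have e1 : b / (1 - b) * (x ^ 2 * b) ≤ 2 * b * (x ^ 2 * √b) := by gcongr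
  have e2 : b / (1 - b) * (x * N) ≤ 2 * b * (x * ((2 * x ^ 2 + 1) * √b)) := by gcongr
  have e3 : 0 ≤ b / (1 - b) * (x ^ 2 * b) := by positivity
  have e4 : 0 ≤ b / (1 - b) * (x * N) := by positivity
  rw [hval, abs_le]
  constructor <;> nlinarith

lemma abs_integral_min_inv_gammaMeasure_sub_sq_le {x b : ℝ} (hx : 0 < x) (hb : 0 < b)
    (hb2 : b < 1 / 2) {ν : Measure ℝ}
    (hν : ν = (gammaMeasure (b⁻¹ + 1) (x * b⁻¹)).map (fun g => g⁻¹)) :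
    |(∫ p, (min p.1 p.2 - x) ^ 2 ∂(ν.prod ν)) - b * x ^ 2|
      ≤ (2 * x ^ 2 + 2 * x * (2 * x ^ 2 + 1)) * b ^ ((3 : ℝ) / 2) := by
  have hb1 : 1 < b⁻¹ := (one_lt_inv₀ hb).2 (by linarith)
  have ha : 2 < b⁻¹ + 1 := by linarith
  have hr : 0 < x * b⁻¹ := by positivity
  have := isProbabilityMeasure_gammaMeasure (show 0 < b⁻¹ + 1 by linarith) hr
  have hinv : Measurable (fun g : ℝ => g⁻¹) := measurable_inv
  have : IsProbabilityMeasure ν := hν ▸ Measure.isProbabilityMeasure_map hinv.aemeasurable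
  have hint : ∀ f : ℝ → ℝ, Measurable f →
      ∫ t, f t ∂ν = ∫ g, f g⁻¹ ∂(gammaMeasure (b⁻¹ + 1) (x * b⁻¹)) := fun f hf => by
    rw [hν, integral_map hinv.aemeasurable hf.aestronglyMeasurable]
  have hL : MemLp (fun t : ℝ => t) 2 ν := by
    rw [hν, memLp_map_measure_iff measurable_id'.aestronglyMeasurable hinv.aemeasurable]
    exact (memLp_two_iff_integrable_sq hinv.aestronglyMeasurable).2
      (integrable_inv_pow_two_gammaMeasure ha hr)
  have h1 : Integrable (fun t : ℝ => t) ν := hL.integrable one_le_two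
  have h2 : Integrable (fun t : ℝ => t ^ 2) ν := hL.integrable_sq
  have hmean : ∫ t, t ∂ν = x := by
    have h := integral_gammaMeasure_deriv_eq_zero (A := 0) (B := b) ha hr
    rw [← hint (fun t => ((b⁻¹ + 1 - 1) * t - x * b⁻¹) * (0 * t + b) - 0 * t ^ 2)
      (by fun_prop)] at h
    have e : (fun t => ((b⁻¹ + 1 - 1) * t - x * b⁻¹) * (0 * t + b) - 0 * t ^ 2)
        = fun t => t - x := by
      ext t; field_simp; ring
    rw [e, integral_sub h1 (integrable_const _), integral_const] at h
    simp only [probReal_univ, smul_eq_mul, one_mul] at h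
    linarith
  refine abs_integral_min_sub_sq_le_of_stein hx hb hb2 hL hmean ?_ ?_
  · have h := integral_gammaMeasure_deriv_eq_zero (A := b) (B := 0) ha hr
    rw [← hint (fun t => ((b⁻¹ + 1 - 1) * t - x * b⁻¹) * (b * t + 0) - b * t ^ 2)
      (by fun_prop)] at h
    have e : (fun t => ((b⁻¹ + 1 - 1) * t - x * b⁻¹) * (b * t + 0) - b * t ^ 2)
        = fun t => (1 - b) * t ^ 2 - x * t := by
      ext t; field_simp; ring
    rw [e, integral_sub (h2.const_mul _) (h1.const_mul _), integral_const_mul,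
      integral_const_mul, hmean] at h
    linarith
  · have hpos : ∀ᵐ y ∂ν, 0 < y := by
      rw [hν, ae_map_iff hinv.aemeasurable measurableSet_Ioi]
      filter_upwards [ae_pos_gammaMeasure_s13 ha] with g hg using inv_pos.2 hg
    filter_upwards [hpos] with y hy
    have hm : Measurable fun t => Real.sign (t - y) :=
      Real.measurable_sign.comp (measurable_id.sub_const y)
    rw [hint _ (by fun_prop)]
    have e : ∀ t, Real.sign (t - y) * ((t - x) * (t - y) - b * t ^ 2) = b *
        (Real.sign (t - y) * (((b⁻¹ + 1 - 1) * t - x * b⁻¹) * (t - y) - t ^ 2)) := by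
      intro t; field_simp; ring
    simp_rw [e]
    rw [integral_const_mul, integral_gammaMeasure_sign_deriv_eq_zero ha hr hy, mul_zero]

/-- If, for each `0 < b < 1`, `X b` and `Y b` are i.i.d. InverseGamma(shape `b⁻¹ + 1`,
scale `x⁻¹ b`) random variables (i.e. their reciprocals are Gamma with shape `b⁻¹ + 1` and
rate `x b⁻¹`), then `E[(min{X,Y} − x)²] = bx² + O_x(b^(3/2))` as `b → 0⁺`. -/
theorem min_invGamma_kernel_second_moment_asymp {Ω : Type*} [MeasureSpace Ω]
    [IsProbabilityMeasure (ℙ : Measure Ω)]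
    (x : ℝ) (hx : 0 < x) (X Y : ℝ → Ω → ℝ)
    (hX : ∀ b, 0 < b → b < 1 →
      Measure.map (fun ω => (X b ω)⁻¹) ℙ = gammaMeasure (b⁻¹ + 1) (x * b⁻¹))
    (hY : ∀ b, 0 < b → b < 1 →
      Measure.map (fun ω => (Y b ω)⁻¹) ℙ = gammaMeasure (b⁻¹ + 1) (x * b⁻¹))
    (hindep : ∀ b, 0 < b → b < 1 → IndepFun (X b) (Y b) ℙ) :
    ∃ C b₀ : ℝ, 0 < C ∧ 0 < b₀ ∧ ∀ b, 0 < b → b < b₀ → b < 1 →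
      |(∫ ω, (min (X b ω) (Y b ω) - x) ^ 2 ∂ℙ) - b * x ^ 2| ≤ C * b ^ ((3 : ℝ) / 2) := by
  refine ⟨2 * x ^ 2 + 2 * x * (2 * x ^ 2 + 1), 1 / 2, by positivity, by norm_num, ?_⟩
  intro b hb hb2 hb1
  have hprob : IsProbabilityMeasure (gammaMeasure (b⁻¹ + 1) (x * b⁻¹)) :=
    isProbabilityMeasure_gammaMeasure (by positivity) (by positivity)
  have hlaw : ∀ Z : Ω → ℝ,
      Measure.map (fun ω => (Z ω)⁻¹) ℙ = gammaMeasure (b⁻¹ + 1) (x * b⁻¹) →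
      AEMeasurable Z ℙ ∧
        Measure.map Z ℙ = (gammaMeasure (b⁻¹ + 1) (x * b⁻¹)).map (fun g => g⁻¹) := by
    intro Z hZ
    have hm : AEMeasurable (fun ω => (Z ω)⁻¹) ℙ :=
      AEMeasurable.of_map_ne_zero (by rw [hZ]; exact IsProbabilityMeasure.ne_zero _)
    refine ⟨by simpa [Pi.inv_def] using hm.inv, ?_⟩
    rw [← hZ, AEMeasurable.map_map_of_aemeasurable measurable_inv.aemeasurable hm]
    congr 1
    ext ω
    simp
  obtain ⟨hXm, hXl⟩ := hlaw (X b) (hX b hb hb1)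
  obtain ⟨hYm, hYl⟩ := hlaw (Y b) (hY b hb hb1)
  have hmap : Measure.map (fun ω => (X b ω, Y b ω)) ℙ
      = (Measure.map (X b) ℙ).prod (Measure.map (X b) ℙ) := by
    rw [(indepFun_iff_map_prod_eq_prod_map_map hXm hYm).1 (hindep b hb hb1), hXl, hYl]
  have key := abs_integral_min_inv_gammaMeasure_sub_sq_le hx hb hb2 hXl
  rwa [← hmap, integral_map (hXm.prodMk hYm) (by fun_prop)] at key
end

section
/- If X, Y are i.i.d. LogNormal(log x, √b) random variables with fixed x > 0, then E[min{X,Y} − x] = x[2 e^(b/2) Φ(−√(b/2)) − 1], and as b → 0⁺ this equals −x√(b/π) + bx/2 + O_x(b^(3/2)). -/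
open MeasureTheory ProbabilityTheory Real

/-- The standard normal cumulative distribution function. -/
noncomputable def stdNormalCDF (z : ℝ) : ℝ :=
  ∫ t in Set.Iic z, Real.exp (-t ^ 2 / 2) / Real.sqrt (2 * π)

lemma gaussianPDFReal_zero_one (t : ℝ) :
    gaussianPDFReal 0 1 t = Real.exp (-t ^ 2 / 2) / Real.sqrt (2 * π) := by
  simp [gaussianPDFReal, div_eq_inv_mul]

lemma stdNormalCDF_eq_gaussianReal (z : ℝ) :
    stdNormalCDF z = (gaussianReal 0 1).real (Set.Iic z) := by
  rw [Measure.real, gaussianReal_apply_eq_integral 0 one_ne_zero,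
    ENNReal.toReal_ofReal (integral_nonneg fun t => gaussianPDFReal_nonneg _ _ _), stdNormalCDF]
  simp_rw [gaussianPDFReal_zero_one]

/-- Exponential tilting shifts the mean of the standard normal distribution. -/
lemma integral_exp_mul_gaussianReal (s : ℝ) (f : ℝ → ℝ) :
    ∫ z, Real.exp (s * z) * f z ∂gaussianReal 0 1 =
      Real.exp (s ^ 2 / 2) * ∫ z, f z ∂gaussianReal s 1 := by
  rw [integral_gaussianReal_eq_integral_smul one_ne_zero,
    integral_gaussianReal_eq_integral_smul one_ne_zero, ← integral_const_mul]
  congr 1 with z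
  simp only [gaussianPDFReal, smul_eq_mul, NNReal.coe_one, mul_one, sub_zero]
  have h : Real.exp (-z ^ 2 / 2) * Real.exp (s * z) =
      Real.exp (s ^ 2 / 2) * Real.exp (-(z - s) ^ 2 / 2) := by
    rw [← Real.exp_add, ← Real.exp_add]
    congr 1
    ring
  linear_combination (√(2 * π))⁻¹ * f z * h

lemma gaussianReal_two_Iic_zero (s : ℝ) :
    (gaussianReal s 2).real (Set.Iic 0) = stdNormalCDF (-(s / √2)) := by
  have h2 : (0 : ℝ) < √2 := by positivity
  have hmap : gaussianReal s 2 = (gaussianReal 0 1).map (fun z => √2 * z + s) := by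
    have h := gaussianReal_map_add_const (μ := √2 * 0) (v := .mk ((√2) ^ 2) (sq_nonneg _) * 1) s
    rw [← gaussianReal_map_const_mul, Measure.map_map (by fun_prop) (by fun_prop)] at h
    rw [show (fun z => √2 * z + s) = (· + s) ∘ (√2 * ·) from rfl, h]
    congr 1
    · simp
    · ext; simp
  rw [hmap, map_measureReal_apply (by fun_prop) measurableSet_Iic, stdNormalCDF_eq_gaussianReal]
  congr 1
  ext z
  simp only [Set.mem_preimage, Set.mem_Iic]
  rw [← neg_div, le_div_iff₀ h2]
  constructor <;> intro h <;> linarith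

lemma gaussianReal_prod_le (s : ℝ) :
    ((gaussianReal s 1).prod (gaussianReal 0 1)).real {p | p.1 ≤ p.2} =
      stdNormalCDF (-(s / √2)) := by
  set P := (gaussianReal s 1).prod (gaussianReal 0 1)
  have hind : IndepFun (fun p : ℝ × ℝ => p.1) (fun p : ℝ × ℝ => -p.2) P :=
    indepFun_prod (X := fun z : ℝ => z) (Y := fun z : ℝ => -z) (by fun_prop) (by fun_prop)
  have h1 : P.map (fun p : ℝ × ℝ => p.1) = gaussianReal s 1 := by
    simp [P]
  have h2 : P.map (fun p : ℝ × ℝ => -p.2) = gaussianReal 0 1 := by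
    have h := Measure.snd_prod (μ := gaussianReal s 1) (ν := gaussianReal 0 1)
    rw [Measure.snd] at h
    rw [show (fun p : ℝ × ℝ => -p.2) = (fun z => -z) ∘ Prod.snd from rfl,
      ← Measure.map_map (by fun_prop) (by fun_prop), h, gaussianReal_map_neg, neg_zero]
  have h3 := gaussianReal_add_gaussianReal_of_indepFun hind h1 h2
  have h4 : gaussianReal s 2 = P.map ((fun p : ℝ × ℝ => p.1) + fun p : ℝ × ℝ => -p.2) := by
    rw [h3]; norm_num
  rw [← gaussianReal_two_Iic_zero, h4,
    map_measureReal_apply (by fun_prop) measurableSet_Iic]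
  congr 1
  ext p
  simp

lemma integrable_exp_mul_fst (s : ℝ) :
    Integrable (fun p : ℝ × ℝ => Real.exp (s * p.1))
      ((gaussianReal 0 1).prod (gaussianReal 0 1)) :=
  (integrable_exp_mul_gaussianReal s).comp_fst _

lemma integrable_min_exp_mul (s : ℝ) :
    Integrable (fun p : ℝ × ℝ => min (Real.exp (s * p.1)) (Real.exp (s * p.2)))
      ((gaussianReal 0 1).prod (gaussianReal 0 1)) :=
  (integrable_exp_mul_fst s).inf ((integrable_exp_mul_gaussianReal s).comp_snd _)

lemma measurableSet_fst_le_snd : MeasurableSet {p : ℝ × ℝ | p.1 ≤ p.2} :=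
  measurableSet_le measurable_fst measurable_snd

lemma setIntegral_exp_mul_fst (s : ℝ) :
    ∫ p in {p : ℝ × ℝ | p.1 ≤ p.2}, Real.exp (s * p.1)
        ∂((gaussianReal 0 1).prod (gaussianReal 0 1)) =
      Real.exp (s ^ 2 / 2) * stdNormalCDF (-(s / √2)) := by
  rw [← gaussianReal_prod_le, ← integral_indicator measurableSet_fst_le_snd,
    integral_prod_symm _ ((integrable_exp_mul_fst s).indicator measurableSet_fst_le_snd),
    ← integral_indicator_one measurableSet_fst_le_snd,
    integral_prod_symm _ ((integrable_const 1).indicator measurableSet_fst_le_snd),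
    ← integral_const_mul]
  congr 1 with y
  rw [← integral_exp_mul_gaussianReal]
  congr 1 with z
  by_cases h : z ≤ y <;> simp [h]

lemma integral_min_exp_mul (s : ℝ) (hs : 0 ≤ s) :
    ∫ p, min (Real.exp (s * p.1)) (Real.exp (s * p.2))
        ∂((gaussianReal 0 1).prod (gaussianReal 0 1)) =
      2 * Real.exp (s ^ 2 / 2) * stdNormalCDF (-(s / √2)) := by
  set P := (gaussianReal 0 1).prod (gaussianReal 0 1)
  have hswap : MeasurePreserving Prod.swap P P := Measure.measurePreserving_swap
  have hfst : ∫ p in {p : ℝ × ℝ | p.1 ≤ p.2}, min (Real.exp (s * p.1)) (Real.exp (s * p.2)) ∂P =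
      Real.exp (s ^ 2 / 2) * stdNormalCDF (-(s / √2)) := by
    rw [← setIntegral_exp_mul_fst]
    refine setIntegral_congr_fun measurableSet_fst_le_snd fun p hp => ?_
    exact min_eq_left (Real.exp_le_exp.2 (mul_le_mul_of_nonneg_left hp hs))
  have hcompl : ({p : ℝ × ℝ | p.1 ≤ p.2}ᶜ : Set (ℝ × ℝ)) =ᵐ[P]
      Prod.swap ⁻¹' {p : ℝ × ℝ | p.1 ≤ p.2} := by
    have := nullSingletonClass_gaussianReal (μ := 0) (v := 1) one_ne_zero
    have hdiag : P {p : ℝ × ℝ | p.1 = p.2} = 0 := by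
      rw [Measure.measure_prod_null (measurableSet_eq_fun measurable_fst measurable_snd)]
      refine Filter.Eventually.of_forall fun z => ?_
      have hz : Prod.mk z ⁻¹' {p : ℝ × ℝ | p.1 = p.2} = {z} := by ext; simp [eq_comm]
      simp [hz]
    have hne : ∀ᵐ p ∂P, p.1 ≠ p.2 := by simpa [ae_iff] using hdiag
    filter_upwards [hne] with p hp
    apply propext
    change ¬ p.1 ≤ p.2 ↔ p.2 ≤ p.1
    rw [not_le]
    exact ⟨le_of_lt, fun h => lt_of_le_of_ne h hp.symm⟩
  rw [← integral_add_compl measurableSet_fst_le_snd (integrable_min_exp_mul s),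
    setIntegral_congr_set hcompl,
    setIntegral_congr_fun (measurable_swap measurableSet_fst_le_snd)
      (fun p _ => min_comm (Real.exp (s * p.1)) (Real.exp (s * p.2)))]
  have hsnd := hswap.setIntegral_preimage_emb MeasurableEquiv.prodComm.measurableEmbedding
    (fun p => min (Real.exp (s * p.1)) (Real.exp (s * p.2))) {p : ℝ × ℝ | p.1 ≤ p.2}
  simp only [Prod.fst_swap, Prod.snd_swap] at hsnd
  rw [hsnd, hfst]
  ring

lemma two_mul_stdNormalCDF_neg_sub_le {u : ℝ} (hu : 0 ≤ u) :
    |2 * stdNormalCDF (-u) - (1 - 2 * u / √(2 * π))| ≤ u ^ 3 := by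
  set φ : ℝ → ℝ := fun t => Real.exp (-t ^ 2 / 2) / √(2 * π)
  have hφ : Integrable φ := by
    simpa only [← gaussianPDFReal_zero_one, φ] using integrable_gaussianPDFReal 0 1
  have hφ1 : ∫ t, φ t = 1 := by
    simpa only [gaussianPDFReal_zero_one] using integral_gaussianPDFReal_eq_one 0 one_ne_zero
  have hneg : ∀ t, φ (-t) = φ t := fun t => by simp [φ]
  have hhalf : 2 * stdNormalCDF 0 = 1 := by
    have h := integral_comp_neg_Iic (0 : ℝ) φ
    simp only [hneg, neg_zero] at h
    have h' := intervalIntegral.integral_Iic_add_Ioi hφ.integrableOn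
      (hφ.integrableOn (s := Set.Ioi 0))
    rw [hφ1, ← h] at h'
    rw [two_mul]
    exact h'
  have hsub : stdNormalCDF 0 - stdNormalCDF (-u) = ∫ t in (0)..u, φ t := by
    have h := intervalIntegral.integral_Iic_sub_Iic (hφ.integrableOn (s := Set.Iic (-u)))
      (hφ.integrableOn (s := Set.Iic 0))
    have h' := intervalIntegral.integral_comp_neg (a := 0) (b := u) φ
    simp only [hneg, neg_zero] at h'
    rw [h', ← h]
    rfl
  have hpi : 1 ≤ √(2 * π) := by
    rw [Real.one_le_sqrt]
    linarith [Real.pi_gt_three]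
  have hbound : |∫ t in (0)..u, (φ t - 1 / √(2 * π))| ≤ u ^ 2 / 2 * |u - 0| := by
    rw [← Real.norm_eq_abs]
    refine intervalIntegral.norm_integral_le_of_norm_le_const fun t ht => ?_
    rw [Set.uIoc_of_le hu] at ht
    have h1 : Real.exp (-t ^ 2 / 2) ≤ 1 := Real.exp_le_one_iff.2 (by nlinarith [sq_nonneg t])
    have h2 := Real.add_one_le_exp (-t ^ 2 / 2)
    have h3 : t ^ 2 ≤ u ^ 2 := pow_le_pow_left₀ ht.1.le ht.2 2
    rw [Real.norm_eq_abs, ← sub_div, abs_div, abs_of_pos (zero_lt_one.trans_le hpi)]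
    refine (div_le_self (abs_nonneg _) hpi).trans ?_
    rw [abs_le]
    constructor <;> nlinarith [sq_nonneg t]
  rw [intervalIntegral.integral_sub hφ.intervalIntegrable intervalIntegrable_const,
    intervalIntegral.integral_const, ← hsub, sub_zero, abs_of_nonneg hu, smul_eq_mul] at hbound
  calc |2 * stdNormalCDF (-u) - (1 - 2 * u / √(2 * π))|
      = 2 * |stdNormalCDF 0 - stdNormalCDF (-u) - u * (1 / √(2 * π))| := by
        rw [← abs_two, ← abs_mul, abs_two, ← abs_neg]
        congr 1
        linear_combination -hhalf
    _ ≤ u ^ 3 := by linarith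

lemma abs_two_mul_exp_mul_stdNormalCDF_sub_le {b : ℝ} (hb : 0 < b) (hb1 : b < 1) :
    |2 * Real.exp (b / 2) * stdNormalCDF (-√(b / 2)) - 1 - (-√(b / π) + b / 2)| ≤
      5 * b ^ ((3 : ℝ) / 2) := by
  have hpow : b ^ ((3 : ℝ) / 2) = b * √b := by
    rw [show (3 : ℝ) / 2 = 1 + 1 / 2 by norm_num, Real.rpow_add hb, Real.rpow_one,
      Real.sqrt_eq_rpow]
  have hbs : b ≤ √b := Real.le_sqrt_of_sq_le (by nlinarith)
  have hs := Real.sqrt_nonneg b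
  have hcdf := two_mul_stdNormalCDF_neg_sub_le (Real.sqrt_nonneg (b / 2))
  have hsq : 2 * √(b / 2) / √(2 * π) = √(b / π) := by
    rw [← Real.sqrt_sq (by positivity : 0 ≤ 2 * √(b / 2) / √(2 * π)), div_pow, mul_pow,
      Real.sq_sqrt (by positivity), Real.sq_sqrt (by positivity)]
    congr 1
    field_simp
  have hcube : √(b / 2) ^ 3 ≤ b * √b := by
    have h1 : √(b / 2) ≤ √b := Real.sqrt_le_sqrt (by linarith)
    have h2 := Real.sq_sqrt (show 0 ≤ b / 2 by linarith)
    rw [pow_succ, h2]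
    exact mul_le_mul (by linarith) h1 (Real.sqrt_nonneg _) hb.le
  have hpi : √(b / π) ≤ √b :=
    Real.sqrt_le_sqrt (div_le_self hb.le (by linarith [Real.pi_gt_three]))
  have hpi0 := Real.sqrt_nonneg (b / π)
  have hexp : |Real.exp (b / 2) - 1 - b / 2| ≤ (b / 2) ^ 2 :=
    Real.abs_exp_sub_one_sub_id_le (by rw [abs_of_pos] <;> linarith)
  rw [hsq] at hcdf
  rw [hpow]
  set r := 2 * stdNormalCDF (-√(b / 2)) - (1 - √(b / π)) with hr
  set E := Real.exp (b / 2)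
  have hE1 : |E - 1| ≤ b := by
    rw [abs_le] at hexp ⊢
    constructor <;> nlinarith
  have hE2 : |E| ≤ 2 := by
    rw [abs_le] at hE1 ⊢
    constructor <;> linarith
  have h1 : |(E - 1) * √(b / π)| ≤ b * √b := by
    rw [abs_mul, abs_of_nonneg hpi0]
    exact mul_le_mul hE1 hpi hpi0 hb.le
  have h2 : |E * r| ≤ 2 * (b * √b) := by
    rw [abs_mul]
    exact mul_le_mul hE2 (hcdf.trans hcube) (abs_nonneg _) zero_le_two
  have h3 : (b / 2) ^ 2 ≤ b * √b := by nlinarith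
  have h4 : 2 * E * stdNormalCDF (-√(b / 2)) - 1 - (-√(b / π) + b / 2) =
      (E - 1 - b / 2) - (E - 1) * √(b / π) + E * r := by
    rw [hr]
    ring
  rw [h4]
  have h5 := abs_add_le ((E - 1 - b / 2) - (E - 1) * √(b / π)) (E * r)
  have h6 := abs_sub (E - 1 - b / 2) ((E - 1) * √(b / π))
  have h7 : 0 ≤ b * √b := by positivity
  linarith


/-- If, for each `b > 0`, `X b = x e^(√b Z₁ b)` and `Y b = x e^(√b Z₂ b)` with `Z₁ b, Z₂ b`
i.i.d. standard normal (so `X b, Y b` are i.i.d. LogNormal(log x, √b)), then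
`E[min{X,Y} − x] = x (2 e^(b/2) Φ(−√(b/2)) − 1)`, and as `b → 0⁺` this equals
`−x √(b/π) + bx/2 + O_x(b^(3/2))`. -/
theorem min_logNormal_kernel_first_moment_asymp {Ω : Type*} [MeasureSpace Ω]
    [IsProbabilityMeasure (ℙ : Measure Ω)]
    (x : ℝ) (hx : 0 < x) (Z₁ Z₂ : ℝ → Ω → ℝ)
    (hZ₁ : ∀ b, 0 < b → Measure.map (Z₁ b) ℙ = gaussianReal 0 1)
    (hZ₂ : ∀ b, 0 < b → Measure.map (Z₂ b) ℙ = gaussianReal 0 1)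
    (hindep : ∀ b, 0 < b → IndepFun (Z₁ b) (Z₂ b) ℙ)
    (X Y : ℝ → Ω → ℝ)
    (hX : ∀ b, X b = fun ω => x * Real.exp (Real.sqrt b * Z₁ b ω))
    (hY : ∀ b, Y b = fun ω => x * Real.exp (Real.sqrt b * Z₂ b ω)) :
    (∀ b, 0 < b →
      ∫ ω, (min (X b ω) (Y b ω) - x) ∂ℙ =
        x * (2 * Real.exp (b / 2) * stdNormalCDF (-Real.sqrt (b / 2)) - 1)) ∧
    ∃ C b₀ : ℝ, 0 < C ∧ 0 < b₀ ∧ ∀ b, 0 < b → b < b₀ →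
      |(∫ ω, (min (X b ω) (Y b ω) - x) ∂ℙ) - (-(x * Real.sqrt (b / π)) + b * x / 2)|
        ≤ C * b ^ ((3 : ℝ) / 2) := by
  have hmean : ∀ b, 0 < b →
      ∫ ω, (min (X b ω) (Y b ω) - x) ∂ℙ =
        x * (2 * Real.exp (b / 2) * stdNormalCDF (-Real.sqrt (b / 2)) - 1) := by
    intro b hb
    set s := √b
    have hs : 0 ≤ s := Real.sqrt_nonneg b
    have hm₁ : AEMeasurable (Z₁ b) ℙ := by
      refine AEMeasurable.of_map_ne_zero ?_
      rw [hZ₁ b hb]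
      exact IsProbabilityMeasure.ne_zero _
    have hm₂ : AEMeasurable (Z₂ b) ℙ := by
      refine AEMeasurable.of_map_ne_zero ?_
      rw [hZ₂ b hb]
      exact IsProbabilityMeasure.ne_zero _
    have hmap := (indepFun_iff_map_prod_eq_prod_map_map hm₁ hm₂).1 (hindep b hb)
    rw [hZ₁ b hb, hZ₂ b hb] at hmap
    set P := (gaussianReal 0 1).prod (gaussianReal 0 1)
    calc ∫ ω, (min (X b ω) (Y b ω) - x) ∂ℙ
        = ∫ ω, x * (min (Real.exp (s * Z₁ b ω)) (Real.exp (s * Z₂ b ω)) - 1) ∂ℙ := by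
          congr 1 with ω
          rw [hX, hY, mul_sub, mul_min_of_nonneg _ _ hx.le, mul_one]
      _ = x * ∫ p, (min (Real.exp (s * p.1)) (Real.exp (s * p.2)) - 1) ∂P := by
          rw [integral_const_mul, ← hmap, integral_map (hm₁.prodMk hm₂)
            (by fun_prop)]
      _ = _ := by
          rw [integral_sub (integrable_min_exp_mul s) (integrable_const 1), integral_min_exp_mul s hs,
            Real.sq_sqrt hb.le, ← Real.sqrt_div hb.le]
          simp
  refine ⟨hmean, 5 * x, 1, by positivity, one_pos, fun b hb hb1 => ?_⟩
  rw [hmean b hb]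
  calc _ = |x * (2 * Real.exp (b / 2) * stdNormalCDF (-√(b / 2)) - 1 - (-√(b / π) + b / 2))| := by
        congr 1
        ring
    _ ≤ 5 * x * b ^ ((3 : ℝ) / 2) := by
        rw [abs_mul, abs_of_pos hx, mul_comm 5 x, mul_assoc x]
        exact mul_le_mul_of_nonneg_left (abs_two_mul_exp_mul_stdNormalCDF_sub_le hb hb1) hx.le
end

section
/- If X, Y are i.i.d. LogNormal(log x, √b) random variables with fixed x > 0, then E[(min{X,Y} − x)²] = x²[2 e^(2b) Φ(−√(2b)) − 4 e^(b/2) Φ(−√(b/2)) + 1] = bx² + O_x(b^(3/2)) as b → 0⁺. -/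
open MeasureTheory ProbabilityTheory Real

lemma integrable_exp_mul_indicator_sub (a : ℝ) {S : Set ℝ} (hS : MeasurableSet S) :
    Integrable (fun p : ℝ × ℝ => exp (a * p.1) * S.indicator 1 (p.1 - p.2))
      ((gaussianReal 0 1).prod (gaussianReal 0 1)) := by
  have hexp : Integrable (fun p : ℝ × ℝ => exp (a * p.1))
      ((gaussianReal 0 1).prod (gaussianReal 0 1)) :=
    (integrable_exp_mul_gaussianReal a).comp_fst _
  refine hexp.mul_bdd (c := 1) ?_ (ae_of_all _ fun p => ?_)
  · exact ((measurable_one.indicator hS).comp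
      (measurable_fst.sub measurable_snd)).aestronglyMeasurable
  · by_cases h : p.1 - p.2 ∈ S <;> simp [h]

/-- Cameron–Martin formula for the standard Gaussian measure on the line. -/
lemma integral_exp_mul_gaussianReal_s15 (a : ℝ) (g : ℝ → ℝ) :
    ∫ u, exp (a * u) * g u ∂gaussianReal 0 1 =
      exp (a ^ 2 / 2) * ∫ u, g (u + a) ∂gaussianReal 0 1 := by
  rw [integral_gaussianReal_eq_integral_smul one_ne_zero,
    integral_gaussianReal_eq_integral_smul one_ne_zero, ← integral_const_mul,
    ← integral_add_right_eq_self (fun u => gaussianPDFReal 0 1 u • (exp (a * u) * g u)) a]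
  refine integral_congr_ae (ae_of_all _ fun u => ?_)
  have h : exp (-(u + a) ^ 2 / 2) * exp (a * (u + a)) = exp (a ^ 2 / 2) * exp (-u ^ 2 / 2) := by
    rw [← exp_add, ← exp_add]; ring_nf
  simp only [gaussianPDFReal, smul_eq_mul, sub_zero, NNReal.coe_one, mul_one]
  linear_combination (√(2 * π))⁻¹ * g (u + a) * h

lemma integral_exp_mul_fst_indicator_sub (a : ℝ) {S : Set ℝ} (hS : MeasurableSet S) :
    ∫ p : ℝ × ℝ, exp (a * p.1) * S.indicator 1 (p.1 - p.2)
        ∂(gaussianReal 0 1).prod (gaussianReal 0 1) =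
      exp (a ^ 2 / 2) * (gaussianReal a 2).real S := by
  have hlaw : ((gaussianReal 0 1).prod (gaussianReal 0 1)).map
      (fun p : ℝ × ℝ => p.1 - p.2 + a) = gaussianReal a 2 := by
    have hneg : ((gaussianReal 0 1).prod (gaussianReal 0 1)).map (fun p : ℝ × ℝ => p.1 - p.2) =
        gaussianReal 0 2 := by
      have := gaussianReal_conv_gaussianReal (m₁ := 0) (m₂ := 0) (v₁ := 1) (v₂ := 1)
      nth_rewrite 2 [← neg_zero (G := ℝ)] at this
      rw [← gaussianReal_map_neg, Measure.conv, ← Measure.map_id (μ := gaussianReal 0 1),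
        Measure.map_map measurable_neg measurable_id,
        Measure.map_prod_map _ _ measurable_id (by fun_prop),
        Measure.map_map (by fun_prop) (by fun_prop)] at this
      norm_num at this
      rw [← this]
      congr 1
    have := gaussianReal_map_add_const (μ := 0) (v := 2) a
    rw [← hneg, Measure.map_map (by fun_prop) (by fun_prop), zero_add] at this
    exact this
  rw [integral_prod_symm _ (integrable_exp_mul_indicator_sub a hS)]
  simp_rw [integral_exp_mul_gaussianReal_s15 a (fun u => S.indicator 1 (u - _))]
  rw [integral_const_mul]
  congr 1
  have hmeas : Measurable (S.indicator (1 : ℝ → ℝ)) := measurable_one.indicator hS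
  rw [← integral_indicator_one hS, ← hlaw, integral_map (by fun_prop) hmeas.aestronglyMeasurable,
    integral_prod_symm]
  · simp_rw [sub_add_eq_add_sub]
  · refine Integrable.of_bound (C := 1) ?_ (ae_of_all _ fun p => ?_)
    · exact (hmeas.comp
        (by fun_prop : Measurable fun p : ℝ × ℝ => p.1 - p.2 + a)).aestronglyMeasurable
    · by_cases h : p.1 - p.2 + a ∈ S <;> simp [h]

lemma gaussianReal_real_Iic (z : ℝ) : (gaussianReal 0 1).real (Set.Iic z) = stdNormalCDF z := by
  rw [measureReal_def, gaussianReal_apply_eq_integral _ one_ne_zero,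
    ENNReal.toReal_ofReal (integral_nonneg fun _ => gaussianPDFReal_nonneg _ _ _), stdNormalCDF]
  refine integral_congr_ae (ae_of_all _ fun u => ?_)
  simp [gaussianPDFReal, div_eq_inv_mul]

lemma gaussianReal_two_real_Iic_zero (a : ℝ) :
    (gaussianReal a 2).real (Set.Iic 0) = stdNormalCDF (-(a / √2)) := by
  have h2 : 0 < √(2 : ℝ) := by positivity
  have hmap : (gaussianReal 0 1).map (fun u => √2 * u + a) = gaussianReal a 2 := by
    have := gaussianReal_map_add_const (μ := 0) (v := 2) a
    have h := gaussianReal_map_const_mul (μ := 0) (v := 1) (√2)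
    have hv : NNReal.mk (√2 ^ 2) (sq_nonneg _) * 1 = 2 := by
      ext; rw [mul_one]; exact sq_sqrt (by norm_num)
    rw [hv, mul_zero] at h
    rw [← h, Measure.map_map (by fun_prop) (by fun_prop), zero_add] at this
    exact this
  rw [← gaussianReal_real_Iic, ← hmap, map_measureReal_apply (by fun_prop) measurableSet_Iic]
  congr 1
  ext u
  simp only [Set.mem_preimage, Set.mem_Iic]
  rw [← neg_div, le_div_iff₀ h2]
  constructor <;> intro h <;> linarith

lemma exp_mul_min_eq_indicator (a : ℝ) (p : ℝ × ℝ) :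
    exp (a * min p.1 p.2) = exp (a * p.1) * (Set.Iic 0).indicator 1 (p.1 - p.2) +
      exp (a * p.2) * (Set.Iio 0).indicator 1 (p.2 - p.1) := by
  rcases le_or_gt p.1 p.2 with h | h
  · simp [h, h.not_gt]
  · simp [h, h.le, h.not_ge]

lemma integrable_exp_mul_min (a : ℝ) :
    Integrable (fun p : ℝ × ℝ => exp (a * min p.1 p.2))
      ((gaussianReal 0 1).prod (gaussianReal 0 1)) := by
  simp_rw [exp_mul_min_eq_indicator]
  exact (integrable_exp_mul_indicator_sub a measurableSet_Iic).add
    (integrable_exp_mul_indicator_sub a measurableSet_Iio).swap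

/-- Moment generating function of the minimum of two independent standard normals. -/
lemma integral_exp_mul_min (a : ℝ) :
    ∫ p : ℝ × ℝ, exp (a * min p.1 p.2) ∂(gaussianReal 0 1).prod (gaussianReal 0 1) =
      2 * exp (a ^ 2 / 2) * stdNormalCDF (-(a / √2)) := by
  have := nullSingletonClass_gaussianReal (μ := a) (v := 2) two_ne_zero
  have hswap : Integrable (fun p : ℝ × ℝ => exp (a * p.2) * (Set.Iio 0).indicator 1 (p.2 - p.1))
      ((gaussianReal 0 1).prod (gaussianReal 0 1)) :=
    (integrable_exp_mul_indicator_sub a measurableSet_Iio).swap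
  have hswap_eq := integral_prod_swap (μ := gaussianReal 0 1) (ν := gaussianReal 0 1)
    fun p : ℝ × ℝ => exp (a * p.1) * (Set.Iio 0).indicator 1 (p.1 - p.2)
  simp only [Prod.fst_swap, Prod.snd_swap] at hswap_eq
  simp_rw [exp_mul_min_eq_indicator]
  rw [integral_add (integrable_exp_mul_indicator_sub a measurableSet_Iic) hswap,
    integral_exp_mul_fst_indicator_sub a measurableSet_Iic,
    hswap_eq, integral_exp_mul_fst_indicator_sub a measurableSet_Iio,
    measureReal_congr Iio_ae_eq_Iic, gaussianReal_two_real_Iic_zero]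
  ring

lemma integral_exp_mul_min_sub_one_sq {b : ℝ} (hb : 0 < b) :
    ∫ p : ℝ × ℝ, (exp (√b * min p.1 p.2) - 1) ^ 2 ∂(gaussianReal 0 1).prod (gaussianReal 0 1) =
      2 * exp (2 * b) * stdNormalCDF (-√(2 * b))
        - 4 * exp (b / 2) * stdNormalCDF (-√(b / 2)) + 1 := by
  have hsq (m : ℝ) : (exp (√b * m) - 1) ^ 2 = exp (2 * √b * m) - 2 * exp (√b * m) + 1 := by
    rw [mul_assoc, two_mul (√b * m), exp_add]; ring
  have h2 : √2 * √2 = (2 : ℝ) := mul_self_sqrt (by norm_num)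
  have hdiv : 2 * √b / √2 = √(2 * b) := by
    rw [sqrt_mul (by norm_num), div_eq_iff (by positivity)]; linear_combination -√b * h2
  simp_rw [hsq]
  rw [integral_add (f := fun p : ℝ × ℝ =>
      exp (2 * √b * min p.1 p.2) - 2 * exp (√b * min p.1 p.2))
    ((integrable_exp_mul_min _).sub ((integrable_exp_mul_min _).const_mul 2))
    (integrable_const 1), integral_sub (integrable_exp_mul_min _)
    ((integrable_exp_mul_min _).const_mul 2), integral_const_mul, integral_exp_mul_min,
    integral_exp_mul_min, hdiv, ← sqrt_div hb.le, mul_pow, sq_sqrt hb.le]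
  simp only [integral_const, probReal_univ, smul_eq_mul]
  ring_nf

lemma integrable_stdNormal_density :
    Integrable (fun t : ℝ => exp (-t ^ 2 / 2) / √(2 * π)) := by
  have h := integrable_gaussianPDFReal 0 1
  refine h.congr (ae_of_all _ fun u => ?_)
  simp [gaussianPDFReal, div_eq_inv_mul]

lemma stdNormalCDF_zero : stdNormalCDF 0 = 1 / 2 := by
  have h := integral_comp_neg_Iic 0 (fun t : ℝ => exp (-t ^ 2 / 2) / √(2 * π))
  simp only [neg_sq, neg_zero] at h
  rw [stdNormalCDF, h, integral_div]
  have h' := integral_gaussian_Ioi (1 / 2)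
  simp only [div_div_eq_mul_div, div_one] at h'
  rw [show (fun t : ℝ => exp (-t ^ 2 / 2)) = fun t => exp (-(1 / 2) * t ^ 2) by
    ext t; ring_nf, h', mul_comm π 2]
  field_simp

/-- Second-order Taylor estimate of the standard normal c.d.f. at the origin. -/
lemma abs_stdNormalCDF_neg_sub_le {z : ℝ} (hz : 0 ≤ z) :
    |stdNormalCDF (-z) - (1 / 2 - z / √(2 * π))| ≤ z ^ 3 := by
  have hc : (1 : ℝ) ≤ √(2 * π) := one_le_sqrt.2 (by linarith [pi_gt_three])
  have hc0 : 0 < √(2 * π) := by positivity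
  have hcdf : stdNormalCDF (-z) = 1 / 2 - (∫ t in (-z)..0, exp (-t ^ 2 / 2)) / √(2 * π) := by
    rw [← stdNormalCDF_zero, ← intervalIntegral.integral_div,
      ← intervalIntegral.integral_Iic_sub_Iic integrable_stdNormal_density.integrableOn
        integrable_stdNormal_density.integrableOn, stdNormalCDF, stdNormalCDF]
    ring
  have hone : ∫ _ in (-z)..0, (1 : ℝ) = z := by simp
  have hI : ‖∫ t in (-z)..0, (1 - exp (-t ^ 2 / 2))‖ ≤ z ^ 2 * |0 - -z| := by
    refine intervalIntegral.norm_integral_le_of_norm_le_const fun t ht => ?_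
    rw [Set.uIoc_of_le (by linarith)] at ht
    have h1 := add_one_le_exp (-t ^ 2 / 2)
    have h2 : exp (-t ^ 2 / 2) ≤ 1 := exp_le_one_iff.2 (by nlinarith [sq_nonneg t])
    have h3 : t ^ 2 ≤ z ^ 2 := by nlinarith [ht.1, ht.2]
    rw [norm_eq_abs, abs_of_nonneg (by linarith)]
    nlinarith [sq_nonneg t]
  rw [intervalIntegral.integral_sub (by simp)
    (Continuous.intervalIntegrable (by fun_prop) _ _), hone, norm_eq_abs] at hI
  simp only [zero_sub, neg_neg, abs_of_nonneg hz] at hI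
  rw [hcdf, show 1 / 2 - (∫ t in (-z)..0, exp (-t ^ 2 / 2)) / √(2 * π) - (1 / 2 - z / √(2 * π)) =
    (z - ∫ t in (-z)..0, exp (-t ^ 2 / 2)) / √(2 * π) by ring, abs_div, abs_of_pos hc0,
    div_le_iff₀ hc0]
  nlinarith [pow_nonneg hz 3]

lemma abs_second_moment_sub_le {b : ℝ} (hb : 0 < b) (hb' : b < 1 / 2) :
    |2 * exp (2 * b) * stdNormalCDF (-√(2 * b))
        - 4 * exp (b / 2) * stdNormalCDF (-√(b / 2)) + 1 - b| ≤ 200 * √b ^ 3 := by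
  set r := √b with hr
  have hr0 : 0 < r := sqrt_pos.2 hb
  have hbr : b = r ^ 2 := (sq_sqrt hb.le).symm
  have hr1 : r < 1 := by nlinarith
  set s := √(b / 2) with hs
  have hs0 : 0 ≤ s := sqrt_nonneg _
  have hs2 : s ^ 2 = b / 2 := sq_sqrt (by linarith)
  have hsr : s ≤ r := sqrt_le_sqrt (by linarith)
  have h2s : √(2 * b) = 2 * s := by
    rw [show 2 * b = 2 ^ 2 * s ^ 2 by rw [hs2]; ring, ← mul_pow, sqrt_sq (by positivity)]
  have hs3 : s ^ 3 ≤ r ^ 3 := by gcongr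
  have hE := abs_exp_sub_one_sub_id_le (x := 2 * b) (by rw [abs_of_pos] <;> linarith)
  have hF := abs_exp_sub_one_sub_id_le (x := b / 2) (by rw [abs_of_pos] <;> linarith)
  have hP := abs_stdNormalCDF_neg_sub_le (z := 2 * s) (by positivity)
  have hQ := abs_stdNormalCDF_neg_sub_le (z := s) (by positivity)
  have hc : 0 < (√(2 * π))⁻¹ := by positivity
  have hc1 : (√(2 * π))⁻¹ ≤ 1 := inv_le_one_of_one_le₀ (one_le_sqrt.2 (by linarith [pi_gt_three]))
  rw [h2s]
  simp only [div_eq_mul_inv _ (√(2 * π))] at hP hQ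
  generalize (√(2 * π))⁻¹ = c at *
  obtain ⟨d, hd⟩ : ∃ d, d = exp (2 * b) - 1 - 2 * b := ⟨_, rfl⟩
  obtain ⟨e, he⟩ : ∃ e, e = exp (b / 2) - 1 - b / 2 := ⟨_, rfl⟩
  obtain ⟨p, hp⟩ : ∃ p, p = stdNormalCDF (-(2 * s)) - (1 / 2 - 2 * s * c) := ⟨_, rfl⟩
  obtain ⟨q, hq⟩ : ∃ q, q = stdNormalCDF (-s) - (1 / 2 - s * c) := ⟨_, rfl⟩
  rw [← hd] at hE
  rw [← he] at hF
  rw [← hp] at hP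
  rw [← hq] at hQ
  rw [show exp (2 * b) = 1 + 2 * b + d by rw [hd]; ring,
    show exp (b / 2) = 1 + b / 2 + e by rw [he]; ring,
    show stdNormalCDF (-(2 * s)) = 1 / 2 - 2 * s * c + p by rw [hp]; ring,
    show stdNormalCDF (-s) = 1 / 2 - s * c + q by rw [hq]; ring]
  have hr4 : r ^ 4 ≤ r ^ 3 := pow_le_pow_of_le_one hr0.le hr1.le (by norm_num)
  have hd' : |d| ≤ 4 * r ^ 3 := hE.trans (by rw [hbr]; nlinarith)
  have he' : |e| ≤ r ^ 3 := hF.trans (by rw [hbr]; nlinarith)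
  have hp' : |p| ≤ 8 * r ^ 3 := hP.trans (by nlinarith)
  have hq' : |q| ≤ r ^ 3 := hQ.trans hs3
  have hr31 : r ^ 3 ≤ 1 := pow_le_one₀ hr0.le hr1.le
  have hsc0 : 0 ≤ s * c := by positivity
  have hsc : s * c ≤ r := by nlinarith
  have hbsc0 : 0 ≤ b * (s * c) := by positivity
  have hbsc : b * (s * c) ≤ r ^ 3 := by rw [hbr]; nlinarith [sq_nonneg r]
  have hprod {u v : ℝ} (hu : |u| ≤ 4 * r ^ 3) (hv : |v| ≤ 1) : |u * v| ≤ 4 * r ^ 3 := by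
    rw [abs_mul]; nlinarith [abs_nonneg u, abs_nonneg v]
  have hdsc : |d * (s * c)| ≤ 4 * r ^ 3 := hprod hd' (by rw [abs_of_nonneg] <;> linarith)
  have hesc : |e * (s * c)| ≤ 4 * r ^ 3 :=
    hprod (by linarith [pow_pos hr0 3]) (by rw [abs_of_nonneg] <;> linarith)
  have hEp : |(1 + 2 * b + d) * p| ≤ 6 * (8 * r ^ 3) := by
    rw [abs_mul]
    refine mul_le_mul ?_ hp' (abs_nonneg _) (by norm_num)
    rw [abs_le] at hd' ⊢
    constructor <;> linarith [hd'.1, hd'.2]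
  have hFq : |(1 + b / 2 + e) * q| ≤ 3 * r ^ 3 := by
    rw [abs_mul]
    refine mul_le_mul ?_ hq' (abs_nonneg _) (by norm_num)
    rw [abs_le] at he' ⊢
    constructor <;> linarith [he'.1, he'.2]
  rw [show 2 * (1 + 2 * b + d) * (1 / 2 - 2 * s * c + p)
      - 4 * (1 + b / 2 + e) * (1 / 2 - s * c + q) + 1 - b =
    d - 2 * e - 6 * (b * (s * c)) - 4 * (d * (s * c)) + 4 * (e * (s * c))
      + 2 * ((1 + 2 * b + d) * p) - 4 * ((1 + b / 2 + e) * q) by ring]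
  rw [abs_le] at hd' he' hdsc hesc hEp hFq ⊢
  constructor <;> linarith [pow_pos hr0 3]

/-- If, for each `b > 0`, `X b = x e^(√b Z₁ b)` and `Y b = x e^(√b Z₂ b)` with `Z₁ b, Z₂ b`
i.i.d. standard normal (so `X b, Y b` are i.i.d. LogNormal(log x, √b)), then
`E[(min{X,Y} − x)²] = x² (2 e^(2b) Φ(−√(2b)) − 4 e^(b/2) Φ(−√(b/2)) + 1)`, which equals
`bx² + O_x(b^(3/2))` as `b → 0⁺`. -/
theorem min_logNormal_kernel_second_moment_asymp {Ω : Type*} [MeasureSpace Ω]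
    [IsProbabilityMeasure (ℙ : Measure Ω)]
    (x : ℝ) (hx : 0 < x) (Z₁ Z₂ : ℝ → Ω → ℝ)
    (hZ₁ : ∀ b, 0 < b → Measure.map (Z₁ b) ℙ = gaussianReal 0 1)
    (hZ₂ : ∀ b, 0 < b → Measure.map (Z₂ b) ℙ = gaussianReal 0 1)
    (hindep : ∀ b, 0 < b → IndepFun (Z₁ b) (Z₂ b) ℙ)
    (X Y : ℝ → Ω → ℝ)
    (hX : ∀ b, X b = fun ω => x * Real.exp (Real.sqrt b * Z₁ b ω))
    (hY : ∀ b, Y b = fun ω => x * Real.exp (Real.sqrt b * Z₂ b ω)) :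
    (∀ b, 0 < b →
      ∫ ω, (min (X b ω) (Y b ω) - x) ^ 2 ∂ℙ =
        x ^ 2 * (2 * Real.exp (2 * b) * stdNormalCDF (-Real.sqrt (2 * b))
          - 4 * Real.exp (b / 2) * stdNormalCDF (-Real.sqrt (b / 2)) + 1)) ∧
    ∃ C b₀ : ℝ, 0 < C ∧ 0 < b₀ ∧ ∀ b, 0 < b → b < b₀ →
      |(∫ ω, (min (X b ω) (Y b ω) - x) ^ 2 ∂ℙ) - b * x ^ 2| ≤ C * b ^ ((3 : ℝ) / 2) := by
  have hmoment (b : ℝ) (hb : 0 < b) : ∫ ω, (min (X b ω) (Y b ω) - x) ^ 2 ∂ℙ =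
      x ^ 2 * (2 * Real.exp (2 * b) * stdNormalCDF (-Real.sqrt (2 * b))
        - 4 * Real.exp (b / 2) * stdNormalCDF (-Real.sqrt (b / 2)) + 1) := by
    have hmeas {Z : Ω → ℝ} (hZ : Measure.map Z ℙ = gaussianReal 0 1) : AEMeasurable Z ℙ :=
      AEMeasurable.of_map_ne_zero (hZ ▸ IsProbabilityMeasure.ne_zero _)
    have hm₁ := hmeas (hZ₁ b hb)
    have hm₂ := hmeas (hZ₂ b hb)
    have hmap := (indepFun_iff_map_prod_eq_prod_map_map hm₁ hm₂).1 (hindep b hb)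
    rw [hZ₁ b hb, hZ₂ b hb] at hmap
    rw [← integral_exp_mul_min_sub_one_sq hb, ← hmap,
      integral_map (hm₁.prodMk hm₂) (by fun_prop), ← integral_const_mul]
    refine integral_congr_ae (ae_of_all _ fun ω => ?_)
    simp only [hX, hY]
    rw [← mul_min_of_nonneg _ _ hx.le, mul_min_of_nonneg _ _ (sqrt_nonneg b),
      ← exp_monotone.map_min]
    ring
  refine ⟨hmoment, 200 * x ^ 2, 1 / 2, by positivity, by norm_num, fun b hb hb' => ?_⟩
  have hpow : b ^ ((3 : ℝ) / 2) = √b ^ 3 := by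
    rw [sqrt_eq_rpow, ← rpow_mul_natCast hb.le]; norm_num
  rw [hmoment b hb, mul_comm b, ← mul_sub, abs_mul, abs_of_pos (by positivity : 0 < x ^ 2), hpow]
  have h := mul_le_mul_of_nonneg_left (abs_second_moment_sub_le hb hb') (sq_nonneg x)
  linarith
end
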